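/- arXiv:1802.03853 — 6 statements merged into one kernel-verified Lean document; each statement's English description precedes it below -/
import Mathlib

section
/- Let X be a locally compact Hausdorff topological space and let Γ be a countable group acting on X by homeomorphisms. For any point x ∈ X, the following are equivalent: (1) the orbit Γ·x is closed in X; (2) the orbit Γ·x is closed in X and discrete, i.e. every point of Γ·x is isolated in Γ·x; (3) for every compact subset K ⊆ X, the intersection K ∩ Γ·x is finite. -/
theorem exists_isOpen_singleton_of_countable (Y : Type*) [TopologicalSpace Y] [T1Space Y]
    [BaireSpace Y] [Countable Y] [Nonempty Y] : ∃ y : Y, IsOpen ({y} : Set Y) := by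
  obtain ⟨y, hy⟩ := nonempty_interior_of_iUnion_of_closed (f := fun y : Y => {y})
    (fun _ => isClosed_singleton) (Set.iUnion_of_singleton Y)
  exact ⟨y, interior_eq_iff_isOpen.mp <|
    (Set.subset_singleton_iff_eq.mp interior_subset).resolve_left hy.ne_empty⟩

theorem MulAction.isDiscrete_orbit_of_isOpen_singleton {X Γ : Type*} [TopologicalSpace X] [Group Γ]
    [MulAction Γ X] (hcont : ∀ γ : Γ, Continuous fun y : X => γ • y) {x : X}
    {y : MulAction.orbit Γ x} (hy : IsOpen {y}) : IsDiscrete (MulAction.orbit Γ x) := by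
  have hsmul (γ : Γ) : Continuous fun z : MulAction.orbit Γ x => γ • z :=
    ((hcont γ).comp continuous_subtype_val).subtype_mk fun z => (γ • z).2
  rw [isDiscrete_iff_discreteTopology, discreteTopology_iff_isOpen_singleton]
  intro z
  obtain ⟨γ, rfl⟩ := MulAction.exists_smul_eq Γ y z
  convert hy.preimage (hsmul γ⁻¹) using 1
  ext w
  simp [inv_smul_eq_iff]

/-- Let `X` be a locally compact Hausdorff space and `Γ` a countable group acting on `X`
by homeomorphisms.  For `x ∈ X`, the following are equivalent:
(1) the orbit `Γ·x` is closed;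
(2) the orbit is closed and discrete (every point of the orbit is isolated in it);
(3) every compact set `K ⊆ X` meets the orbit in a finite set. -/
theorem closed_orbit_tfae {X : Type*} [TopologicalSpace X] [LocallyCompactSpace X] [T2Space X]
    (Γ : Type*) [Group Γ] [Countable Γ] [MulAction Γ X]
    (hcont : ∀ γ : Γ, Continuous fun y : X => γ • y) (x : X) :
    List.TFAE
      [IsClosed (MulAction.orbit Γ x),
       IsClosed (MulAction.orbit Γ x) ∧
         ∀ y ∈ MulAction.orbit Γ x,
           ∃ U : Set X, IsOpen U ∧ U ∩ MulAction.orbit Γ x = {y},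
       ∀ K : Set X, IsCompact K → (K ∩ MulAction.orbit Γ x).Finite] := by
  rw [← isDiscrete_iff_forall_mem_exists_isOpen]
  tfae_have 1 → 2 := fun h => by
    have : LocallyCompactSpace (MulAction.orbit Γ x) :=
      h.isClosedEmbedding_subtypeVal.locallyCompactSpace
    have : Nonempty (MulAction.orbit Γ x) := (MulAction.nonempty_orbit x).to_subtype
    have : Countable (MulAction.orbit Γ x) := Set.countable_range (fun γ : Γ => γ • x)
    obtain ⟨y, hy⟩ := exists_isOpen_singleton_of_countable (MulAction.orbit Γ x)
    exact ⟨h, MulAction.isDiscrete_orbit_of_isOpen_singleton hcont hy⟩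
  tfae_have 2 → 3 := fun ⟨hc, hd⟩ K hK =>
    (hK.inter_right hc).finite (hd.mono Set.inter_subset_right)
  tfae_have 3 → 1 := fun h =>
    (CompactlyGeneratedSpace.isClosed_iff_of_t2 _).mpr fun K hK => by
      rw [Set.inter_comm]
      exact (h K hK).isClosed
  tfae_finish
end

section
/- Fix a real number k > 1. Let (K_n)_{n∈ℕ} be a sequence of globally k-thick subsets of ℝ such that 0 ∈ K_n for every n. Then the Kuratowski upper limit K = ⋂_{N∈ℕ} closure(⋃_{n≥N} K_n) contains 0 and is globally k-thick. -/
/-- For `k > 1`, a set `T ⊆ ℝ` is `k`-thick if it is closed and for every `x ≥ 0`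
there is `t ∈ T` with `x ≤ |t| ≤ k·x`. -/
def IsKThick (k : ℝ) (T : Set ℝ) : Prop :=
  IsClosed T ∧ ∀ x : ℝ, 0 ≤ x → ∃ t ∈ T, x ≤ |t| ∧ |t| ≤ k * x

/-- `T` is globally `k`-thick if `T - s` is `k`-thick for every `s ∈ T`. -/
def IsGloballyKThick (k : ℝ) (T : Set ℝ) : Prop :=
  ∀ s ∈ T, IsKThick k ((fun t => t - s) '' T)

open Filter Topology in
/-- Near any point of the upper limit there are points of `K n` with `n` arbitrarily large. -/
theorem exists_seq_tendsto_of_mem_upperLimit {K : ℕ → Set ℝ} {s : ℝ}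
    (hs : s ∈ ⋂ N : ℕ, closure (⋃ n ∈ Set.Ici N, K n)) :
    ∃ (n : ℕ → ℕ) (u : ℕ → ℝ), (∀ N, N ≤ n N) ∧ (∀ N, u N ∈ K (n N)) ∧
      Tendsto u atTop (𝓝 s) := by
  have hnear : ∀ N : ℕ, ∃ n, ∃ u ∈ K n, N ≤ n ∧ dist u s < 1 / ((N : ℝ) + 1) := by
    intro N
    obtain ⟨u, hu, hus⟩ := Metric.mem_closure_iff.1 (Set.mem_iInter.1 hs N)
      (1 / ((N : ℝ) + 1)) (by positivity)
    simp only [Set.mem_iUnion, Set.mem_Ici] at hu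
    obtain ⟨n, hn, hun⟩ := hu
    exact ⟨n, u, hun, hn, by rwa [dist_comm]⟩
  choose n u huK hn hdist using hnear
  refine ⟨n, u, hn, huK, tendsto_iff_dist_tendsto_zero.2 ?_⟩
  exact squeeze_zero (fun _ => dist_nonneg) (fun N => (hdist N).le)
    tendsto_one_div_add_atTop_nhds_zero_nat

open Filter Topology in
/-- A limit of points of `K (n j)` with `n j → ∞` lies in the upper limit of `K`. -/
theorem mem_upperLimit_of_tendsto {K : ℕ → Set ℝ} {t : ℝ} {n : ℕ → ℕ} {u : ℕ → ℝ}
    (hn : Tendsto n atTop atTop) (hu : ∀ j, u j ∈ K (n j)) (hut : Tendsto u atTop (𝓝 t)) :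
    t ∈ ⋂ N : ℕ, closure (⋃ n ∈ Set.Ici N, K n) := by
  refine Set.mem_iInter.2 fun N => mem_closure_of_tendsto hut ?_
  filter_upwards [hn.eventually_ge_atTop N] with j hj
  exact Set.mem_biUnion hj (hu j)

/-- If each `K n` is globally `k`-thick and contains `0`, then the Kuratowski upper limit
`⋂ N, closure (⋃ n ≥ N, K n)` contains `0` and is globally `k`-thick. -/
theorem limsup_globally_thick (k : ℝ) (hk : 1 < k) (K : ℕ → Set ℝ)
    (hthick : ∀ n, IsGloballyKThick k (K n)) (h0 : ∀ n, (0 : ℝ) ∈ K n) :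
    ((0 : ℝ) ∈ ⋂ N : ℕ, closure (⋃ n ∈ Set.Ici N, K n)) ∧
      IsGloballyKThick k (⋂ N : ℕ, closure (⋃ n ∈ Set.Ici N, K n)) := by
  refine ⟨mem_upperLimit_of_tendsto Filter.tendsto_id h0 tendsto_const_nhds, fun s hs => ⟨?_, ?_⟩⟩
  · exact (Homeomorph.subRight s).isClosedMap _ (isClosed_iInter fun _ => isClosed_closure)
  intro x hx
  obtain ⟨n, u, hn, huK, hus⟩ := exists_seq_tendsto_of_mem_upperLimit hs
  have hex : ∀ N, ∃ t ∈ K (n N), x ≤ |t - u N| ∧ |t - u N| ≤ k * x := by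
    intro N
    obtain ⟨_, ⟨t, ht, rfl⟩, hxt⟩ := (hthick (n N) (u N) (huK N)).2 x hx
    exact ⟨t, ht, hxt⟩
  choose t htK hlow hupp using hex
  obtain ⟨d, -, φ, hφ, hd⟩ := tendsto_subseq_of_bounded
    (Metric.isBounded_closedBall (x := (0 : ℝ)) (r := k * x)) (x := fun N => t N - u N)
    fun N => by simpa using hupp N
  have htφ : Filter.Tendsto (fun j => t (φ j)) Filter.atTop (nhds (d + s)) := by
    simpa [Function.comp_def] using hd.add (hus.comp hφ.tendsto_atTop)
  refine ⟨d, ⟨d + s, ?_, add_sub_cancel_right d s⟩,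
    ge_of_tendsto' hd.abs fun j => hlow (φ j), le_of_tendsto' hd.abs fun j => hupp (φ j)⟩
  exact mem_upperLimit_of_tendsto
    ((Filter.tendsto_atTop_mono hn Filter.tendsto_id).comp hφ.tendsto_atTop)
    (fun j => htK (φ j)) htφ
end

section
/- Let Λ ⊆ S² be a Sierpiński curve: Λ is compact and S² \ Λ = ⋃_{n∈ℕ} D_n, where the D_n are Jordan disks in S² with pairwise disjoint closures, diam(D_n) → 0, and ⋃_n D_n is dense in S². Let P ⊆ ℝ³ be an affine plane such that both open half-spaces determined by P meet Λ, and let C = S² ∩ P be the corresponding circle on S². Then C ∩ Λ contains a Cantor set; in particular, C ∩ Λ is uncountable. -/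
open scoped RealInnerProductSpace

/-- The unit sphere `S² ⊆ ℝ³`. -/
def S2 : Set (EuclideanSpace ℝ (Fin 3)) := Metric.sphere 0 1

/-- A Jordan disk in `S²`: an open subset `D` of `S²` such that some homeomorphism of the
closed unit disk in `ℂ` onto the closure of `D` carries the open unit disk onto `D`. -/
def IsJordanDisk (D : Set (EuclideanSpace ℝ (Fin 3))) : Prop :=
  D ⊆ S2 ∧ (∃ V : Set (EuclideanSpace ℝ (Fin 3)), IsOpen V ∧ D = V ∩ S2) ∧
    ∃ f : ℂ → EuclideanSpace ℝ (Fin 3),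
      ContinuousOn f (Metric.closedBall 0 1) ∧
      Set.InjOn f (Metric.closedBall 0 1) ∧
      f '' Metric.closedBall 0 1 = closure D ∧
      f '' Metric.ball 0 1 = D

/-- A Cantor set: a nonempty, compact, perfect, totally disconnected subset. -/
def IsCantorSet {X : Type*} [TopologicalSpace X] (K : Set X) : Prop :=
  K.Nonempty ∧ IsCompact K ∧ Perfect K ∧ IsTotallyDisconnected K

open Set Topology in
/-- A set that is the image of Cantor space under a continuous injection is a Cantor set. -/
theorem isCantorSet_range {X : Type*} [TopologicalSpace X] [T2Space X] {f : (ℕ → Bool) → X}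
    (hf : Continuous f) (hinj : Function.Injective f) : IsCantorSet (range f) := by
  refine ⟨range_nonempty f, isCompact_range hf, ⟨(isCompact_range hf).isClosed, ?_⟩, ?_⟩
  · rw [preperfect_iff_nhds]
    rintro _ ⟨x, rfl⟩ U hU
    have hlim : Filter.Tendsto (fun n => Function.update x n (!x n)) Filter.atTop (𝓝 x) := by
      rw [tendsto_pi_nhds]
      intro m
      refine tendsto_const_nhds.congr' ?_
      filter_upwards [Filter.eventually_gt_atTop m] with n hn
      rw [Function.update_of_ne hn.ne]
    obtain ⟨n, hn⟩ := (((hf.tendsto x).comp hlim).eventually hU).exists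
    refine ⟨_, ⟨hn, mem_range_self _⟩, fun h => ?_⟩
    have := congrFun (hinj h) n
    simp at this
  · exact (hf.isClosedEmbedding hinj).isEmbedding.isTotallyDisconnected_range.mpr inferInstance

open Set Topology in
/-- A preconnected set meeting both a set and its complement meets its frontier. -/
theorem IsPreconnected.inter_frontier_nonempty_of_mem {X : Type*} [TopologicalSpace X]
    {V A : Set X} (hV : IsPreconnected V) {x y : X} (hx : x ∈ V) (hxA : x ∉ A) (hy : y ∈ V)
    (hyA : y ∈ A) : (V ∩ frontier A).Nonempty := by
  have : PreconnectedSpace V := isPreconnected_iff_preconnectedSpace.mp hV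
  have h : (frontier ((↑) ⁻¹' A : Set V)).Nonempty :=
    nonempty_frontier_iff.mpr ⟨⟨⟨y, hy⟩, hyA⟩, fun h => hxA (h.ge (mem_univ (⟨x, hx⟩ : V)))⟩
  obtain ⟨z, hz⟩ := h
  exact ⟨z, z.2, continuous_subtype_val.frontier_preimage_subset A hz⟩

open Set Topology in
/-- **Sierpiński's theorem** for complete metric spaces: a countable partition of a connected,
locally connected complete metric space into closed sets is trivial. -/
theorem exists_eq_univ_of_iUnion_isClosed_eq_univ {X ι : Type*} [MetricSpace X] [CompleteSpace X]
    [ConnectedSpace X] [LocallyConnectedSpace X] [Countable ι] {F : ι → Set X}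
    (hF : ∀ i, IsClosed (F i)) (hdisj : ∀ i j, i ≠ j → Disjoint (F i) (F j))
    (hcov : ⋃ i, F i = univ) : ∃ i, F i = univ := by
  by_contra! hne
  have hidx : ∀ {i j x}, x ∈ F i → x ∈ F j → i = j := fun {i j x} hi hj => by
    by_contra h
    exact disjoint_left.mp (hdisj i j h) hi hj
  have hmem : ∀ x, ∃ i, x ∈ F i := fun x => mem_iUnion.mp (hcov.ge (mem_univ x))
  set B : Set X := (⋃ i, interior (F i))ᶜ with hB
  have hBc : IsClosed B := (isOpen_iUnion fun i => isOpen_interior).isClosed_compl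
  have hfr : ∀ i, frontier (F i) ⊆ B ∩ F i := by
    intro i x hx
    have hxi : x ∈ F i := (hF i).frontier_subset hx
    refine ⟨fun h => ?_, hxi⟩
    obtain ⟨j, hj⟩ := mem_iUnion.mp h
    obtain rfl := hidx hxi (interior_subset hj)
    exact hx.2 hj
  have hBne : Nonempty B := by
    obtain ⟨x⟩ := (inferInstance : Nonempty X)
    obtain ⟨i, hi⟩ := hmem x
    obtain ⟨z, hz⟩ := nonempty_frontier_iff.mpr ⟨⟨x, hi⟩, hne i⟩
    exact ⟨z, (hfr i hz).1⟩
  have : CompleteSpace B := hBc.completeSpace_coe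
  obtain ⟨i, ⟨x, hxB⟩, hx⟩ := nonempty_interior_of_iUnion_of_closed
    (f := fun i => ((↑) ⁻¹' F i : Set B)) (fun i => (hF i).preimage continuous_subtype_val)
    (by rw [← preimage_iUnion, hcov, preimage_univ])
  obtain ⟨W, hW, hWo, hxW⟩ := mem_interior.mp hx
  obtain ⟨U, hU, rfl⟩ := isOpen_induced_iff.mp hWo
  have hUB : ∀ y ∈ U, y ∈ B → y ∈ F i := fun y hy hyB => @hW ⟨y, hyB⟩ hy
  obtain ⟨V, hVU, hVo, hxV, hV⟩ := locallyConnectedSpace_iff_subsets_isOpen_isConnected.mp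
    inferInstance x U (hU.mem_nhds hxW)
  obtain ⟨y, hyV, hyi⟩ : ∃ y ∈ V, y ∉ F i := by
    by_contra! h
    exact hxB (mem_iUnion.mpr ⟨i, mem_interior.mpr ⟨V, h, hVo, hxV⟩⟩)
  obtain ⟨j, hj⟩ := hmem y
  have hxj : x ∉ F j := fun h => hyi (hidx h (hUB x hxW hxB) ▸ hj)
  obtain ⟨z, hzV, hz⟩ := hV.isPreconnected.inter_frontier_nonempty_of_mem hxV hxj hyV hj
  have := hfr j hz
  exact hyi (hidx this.2 (hUB z (hVU hzV) this.1) ▸ hj)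

open Complex in
/-- Two continuous logarithms of the same function on a connected space differ by a constant. -/
theorem sub_eq_sub_of_exp_eq_exp {X : Type*} [TopologicalSpace X] [PreconnectedSpace X]
    {f g : X → ℂ} (hf : Continuous f) (hg : Continuous g) (h : ∀ x, exp (f x) = exp (g x))
    (x y : X) : f x - g x = f y - g y :=
  isCoveringMap_exp.const_of_comp (hf.sub hg)
    (fun a b => Subtype.ext (by simp [exp_sub, h])) x y

open Complex in
/-- The loop `t ↦ r * exp (I * t) - w` with `‖w‖ < r` is not null-homotopic in `ℂ \ {0}`. -/
theorem not_nullhomotopic_circle {r : ℝ} {w : ℂ} (hw : ‖w‖ < r) {H : ℝ × ℝ → ℂ}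
    (hH : Continuous H) (hne : ∀ p, H p ≠ 0)
    (hper : ∀ s, H (s, 2 * Real.pi) = H (s, 0)) (hzero : ∀ t, H (0, t) = H (0, 0))
    (hone : ∀ t : ℝ, H (1, t) = r * exp (t * I) - w) : False := by
  obtain ⟨L, ⟨-, hL⟩, -⟩ := isCoveringMapOn_exp.existsUnique_continuousMap_lifts
    (⟨H, hH⟩ : C(ℝ × ℝ, ℂ)) (a₀ := (0, 0)) (e₀ := log (H (0, 0))) (exp_log (hne _))
    (fun a => hne a)
  have hexp : ∀ p, exp (L p) = H p := fun p => congrFun hL p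
  have hLc := L.continuous
  have h1 : L (1, 2 * Real.pi) - L (1, 0) = L (0, 2 * Real.pi) - L (0, 0) :=
    sub_eq_sub_of_exp_eq_exp (f := fun s : ℝ => L (s, 2 * Real.pi)) (g := fun s : ℝ => L (s, 0))
      (by fun_prop) (by fun_prop) (fun s => by rw [hexp, hexp, hper]) 1 0
  have h0 : L (0, 2 * Real.pi) - L (0, 0) = L (0, 0) - L (0, 0) :=
    sub_eq_sub_of_exp_eq_exp (f := fun t : ℝ => L (0, t)) (g := fun _ => L (0, 0))
      (by fun_prop) (by fun_prop) (fun t => by rw [hexp, hexp, hzero]) _ _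
  have hslit : ∀ t : ℝ, (r : ℂ) - w * exp (-(t * I)) ∈ slitPlane := by
    intro t
    left
    have hnorm : ‖w * exp (-(t * I))‖ = ‖w‖ := by
      rw [norm_mul, ← neg_mul, ← ofReal_neg, norm_exp_ofReal_mul_I, mul_one]
    have := re_le_norm (w * exp (-(t * I)))
    rw [sub_re, ofReal_re]
    linarith
  have h2 := sub_eq_sub_of_exp_eq_exp (f := fun t : ℝ => L (1, t))
    (g := fun t : ℝ => t * I + log (r - w * exp (-(t * I)))) (by fun_prop)
    ((by fun_prop : Continuous fun t : ℝ => (t : ℂ) * I).add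
      (Continuous.clog (by fun_prop) hslit))
    (fun t => by
      rw [hexp, hone, exp_add, exp_log (slitPlane_ne_zero (hslit t)), mul_sub, mul_left_comm,
        ← exp_add]
      simp [mul_comm]) (2 * Real.pi) 0
  have hp : exp (-((2 * Real.pi : ℝ) * I)) = 1 := by
    rw [exp_neg]; push_cast; rw [exp_two_pi_mul_I, inv_one]
  have h3 : L (1, 2 * Real.pi) = L (1, 0) := by linear_combination h1 + h0
  simp only [hp, h3, ofReal_zero, zero_mul, neg_zero, exp_zero] at h2
  have h4 : ((2 * Real.pi : ℝ) : ℂ) * I = 0 := by linear_combination -h2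
  simp [Real.pi_ne_zero] at h4

/-- Projection of `x` to the plane of the first two coordinates along the direction of the line
through `p` and `q`, normalised so that this line is sent to `0`. -/
noncomputable def lineProj (b : OrthonormalBasis (Fin 3) ℝ (EuclideanSpace ℝ (Fin 3)))
    (p q x : EuclideanSpace ℝ (Fin 3)) : ℂ :=
  ⟨⟪b 0, x⟫ - ⟪b 0, p⟫ - (⟪b 2, x⟫ - ⟪b 2, p⟫) / (⟪b 2, q⟫ - ⟪b 2, p⟫) * (⟪b 0, q⟫ - ⟪b 0, p⟫),
    ⟪b 1, x⟫ - ⟪b 1, p⟫ - (⟪b 2, x⟫ - ⟪b 2, p⟫) / (⟪b 2, q⟫ - ⟪b 2, p⟫) * (⟪b 1, q⟫ - ⟪b 1, p⟫)⟩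

theorem continuous_lineProj (b : OrthonormalBasis (Fin 3) ℝ (EuclideanSpace ℝ (Fin 3)))
    (p q : EuclideanSpace ℝ (Fin 3)) : Continuous (lineProj b p q) := by
  have : lineProj b p q = fun x => Complex.equivRealProdCLM.symm
      (⟪b 0, x⟫ - ⟪b 0, p⟫ - (⟪b 2, x⟫ - ⟪b 2, p⟫) / (⟪b 2, q⟫ - ⟪b 2, p⟫) *
        (⟪b 0, q⟫ - ⟪b 0, p⟫),
      ⟪b 1, x⟫ - ⟪b 1, p⟫ - (⟪b 2, x⟫ - ⟪b 2, p⟫) / (⟪b 2, q⟫ - ⟪b 2, p⟫) *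
        (⟪b 1, q⟫ - ⟪b 1, p⟫)) := by
    funext x
    apply Complex.ext <;> rfl
  rw [this]
  fun_prop

theorem sum_sq_inner_of_mem_S2 (b : OrthonormalBasis (Fin 3) ℝ (EuclideanSpace ℝ (Fin 3)))
    {x : EuclideanSpace ℝ (Fin 3)} (hx : x ∈ S2) :
    ⟪b 0, x⟫ ^ 2 + ⟪b 1, x⟫ ^ 2 + ⟪b 2, x⟫ ^ 2 = 1 := by
  have h := b.sum_sq_inner_right x
  rw [Fin.sum_univ_three, mem_sphere_zero_iff_norm.mp hx, one_pow] at h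
  exact h

/-- On the sphere, `lineProj b p q` vanishes at most at `p` and `q`. -/
theorem eq_or_eq_of_lineProj_eq_zero
    (b : OrthonormalBasis (Fin 3) ℝ (EuclideanSpace ℝ (Fin 3)))
    {p q x : EuclideanSpace ℝ (Fin 3)} (hp : p ∈ S2) (hq : q ∈ S2) (hx : x ∈ S2)
    (hpq : ⟪b 2, p⟫ < ⟪b 2, q⟫) (h : lineProj b p q x = 0) : x = p ∨ x = q := by
  have h0 := congrArg Complex.re h
  have h1 := congrArg Complex.im h
  simp only [lineProj, Complex.zero_re, Complex.zero_im] at h0 h1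
  have hp1 := sum_sq_inner_of_mem_S2 b hp
  have hq1 := sum_sq_inner_of_mem_S2 b hq
  have hx1 := sum_sq_inner_of_mem_S2 b hx
  have hd : 0 < ⟪b 2, q⟫ - ⟪b 2, p⟫ := sub_pos.mpr hpq
  set l := (⟪b 2, x⟫ - ⟪b 2, p⟫) / (⟪b 2, q⟫ - ⟪b 2, p⟫) with hl
  have e0 : ⟪b 0, x⟫ = ⟪b 0, p⟫ + l * (⟪b 0, q⟫ - ⟪b 0, p⟫) := by linarith
  have e1 : ⟪b 1, x⟫ = ⟪b 1, p⟫ + l * (⟪b 1, q⟫ - ⟪b 1, p⟫) := by linarith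
  have e2 : ⟪b 2, x⟫ = ⟪b 2, p⟫ + l * (⟪b 2, q⟫ - ⟪b 2, p⟫) := by
    rw [hl, div_mul_cancel₀ _ hd.ne']; ring
  rw [e0, e1, e2] at hx1
  have hpos : 0 < (⟪b 0, q⟫ - ⟪b 0, p⟫) ^ 2 + (⟪b 1, q⟫ - ⟪b 1, p⟫) ^ 2 +
    (⟪b 2, q⟫ - ⟪b 2, p⟫) ^ 2 := by positivity
  have hmul : l * (l - 1) * ((⟪b 0, q⟫ - ⟪b 0, p⟫) ^ 2 + (⟪b 1, q⟫ - ⟪b 1, p⟫) ^ 2 +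
    (⟪b 2, q⟫ - ⟪b 2, p⟫) ^ 2) = 0 := by
    linear_combination hx1 - (1 - l) * hp1 - l * hq1
  have hext : ∀ y : EuclideanSpace ℝ (Fin 3), ⟪b 0, x⟫ = ⟪b 0, y⟫ → ⟪b 1, x⟫ = ⟪b 1, y⟫ →
      ⟪b 2, x⟫ = ⟪b 2, y⟫ → x = y := fun y y0 y1 y2 => by
    apply b.repr.injective
    ext i
    rw [b.repr_apply_apply, b.repr_apply_apply]
    fin_cases i <;> assumption
  rcases mul_eq_zero.mp ((mul_eq_zero.mp hmul).resolve_right hpos.ne') with h | h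
  · left
    rw [h] at e0 e1 e2
    exact hext p (by linarith) (by linarith) (by linarith)
  · right
    rw [sub_eq_zero.mp h] at e0 e1 e2
    exact hext q (by linarith) (by linarith) (by linarith)

/-- The parametrised circle of radius `r` in the plane at height `c` along `b 2`. -/
noncomputable def circleParam (b : OrthonormalBasis (Fin 3) ℝ (EuclideanSpace ℝ (Fin 3)))
    (r c t : ℝ) : EuclideanSpace ℝ (Fin 3) :=
  (r * Real.cos t) • b 0 + (r * Real.sin t) • b 1 + c • b 2

theorem continuous_circleParam (b : OrthonormalBasis (Fin 3) ℝ (EuclideanSpace ℝ (Fin 3)))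
    (r c : ℝ) : Continuous (circleParam b r c) := by
  unfold circleParam
  fun_prop

theorem inner_circleParam (b : OrthonormalBasis (Fin 3) ℝ (EuclideanSpace ℝ (Fin 3)))
    (r c t : ℝ) : ⟪b 0, circleParam b r c t⟫ = r * Real.cos t ∧
      ⟪b 1, circleParam b r c t⟫ = r * Real.sin t ∧ ⟪b 2, circleParam b r c t⟫ = c := by
  simp [circleParam, inner_add_right, inner_smul_right, b.inner_eq_ite]

theorem circleParam_mem_S2 (b : OrthonormalBasis (Fin 3) ℝ (EuclideanSpace ℝ (Fin 3)))
    {r c : ℝ} (h : r ^ 2 + c ^ 2 = 1) (t : ℝ) : circleParam b r c t ∈ S2 := by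
  obtain ⟨h0, h1, h2⟩ := inner_circleParam b r c t
  have hs := b.sum_sq_inner_right (circleParam b r c t)
  rw [Fin.sum_univ_three, h0, h1, h2] at hs
  have hn : ‖circleParam b r c t‖ ^ 2 = 1 := by
    rw [← hs]
    linear_combination h + r ^ 2 * Real.sin_sq_add_cos_sq t
  exact mem_sphere_zero_iff_norm.mpr
    ((pow_eq_one_iff_of_nonneg (norm_nonneg _) two_ne_zero).mp hn)

/-- If `p` and `q` lie on the sphere strictly below and above height `c`, then `lineProj b p q`
maps the circle at height `c` to a round circle enclosing `0`. -/
theorem exists_lineProj_circleParam_eq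
    (b : OrthonormalBasis (Fin 3) ℝ (EuclideanSpace ℝ (Fin 3)))
    {p q : EuclideanSpace ℝ (Fin 3)} (hp : p ∈ S2) (hq : q ∈ S2) {r c : ℝ} (hr : 0 < r)
    (h : r ^ 2 + c ^ 2 = 1) (hpc : ⟪b 2, p⟫ < c) (hqc : c < ⟪b 2, q⟫) :
    ∃ w : ℂ, ‖w‖ < r ∧ ∀ t : ℝ, lineProj b p q (circleParam b r c t) =
      r * Complex.exp (t * Complex.I) - w := by
  have hp1 := sum_sq_inner_of_mem_S2 b hp
  have hq1 := sum_sq_inner_of_mem_S2 b hq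
  have hd : 0 < ⟪b 2, q⟫ - ⟪b 2, p⟫ := by linarith
  set s := (c - ⟪b 2, p⟫) / (⟪b 2, q⟫ - ⟪b 2, p⟫) with hs
  have hs0 : 0 < s := div_pos (by linarith) hd
  have hs1 : s < 1 := (div_lt_one hd).mpr (by linarith)
  have e2 : c = ⟪b 2, p⟫ + s * (⟪b 2, q⟫ - ⟪b 2, p⟫) := by
    rw [hs, div_mul_cancel₀ _ hd.ne']; ring
  refine ⟨⟨⟪b 0, p⟫ + s * (⟪b 0, q⟫ - ⟪b 0, p⟫), ⟪b 1, p⟫ + s * (⟪b 1, q⟫ - ⟪b 1, p⟫)⟩, ?_,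
    fun t => ?_⟩
  · refine lt_of_pow_lt_pow_left₀ 2 hr.le ?_
    rw [Complex.sq_norm, Complex.normSq_mk]
    have hpos : 0 < s * (1 - s) * ((⟪b 0, q⟫ - ⟪b 0, p⟫) ^ 2 + (⟪b 1, q⟫ - ⟪b 1, p⟫) ^ 2 +
        (⟪b 2, q⟫ - ⟪b 2, p⟫) ^ 2) :=
      mul_pos (mul_pos hs0 (sub_pos.mpr hs1)) (by positivity)
    rw [e2] at h
    have hid : r ^ 2 - ((⟪b 0, p⟫ + s * (⟪b 0, q⟫ - ⟪b 0, p⟫)) *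
        (⟪b 0, p⟫ + s * (⟪b 0, q⟫ - ⟪b 0, p⟫)) + (⟪b 1, p⟫ + s * (⟪b 1, q⟫ - ⟪b 1, p⟫)) *
        (⟪b 1, p⟫ + s * (⟪b 1, q⟫ - ⟪b 1, p⟫))) = s * (1 - s) * ((⟪b 0, q⟫ - ⟪b 0, p⟫) ^ 2 +
        (⟪b 1, q⟫ - ⟪b 1, p⟫) ^ 2 + (⟪b 2, q⟫ - ⟪b 2, p⟫) ^ 2) := by
      linear_combination h - (1 - s) * hp1 - s * hq1
    linarith
  · obtain ⟨h0, h1, h2⟩ := inner_circleParam b r c t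
    rw [lineProj, h0, h1, h2, ← hs]
    apply Complex.ext
    · simp [Complex.exp_ofReal_mul_I_re]; ring
    · simp [Complex.exp_ofReal_mul_I_im]; ring

open Set Topology in
/-- A continuous map into the image of a compact set under a continuous injection lifts
continuously. -/
theorem exists_continuous_lift_of_injOn {X Y Z : Type*} [TopologicalSpace X] [TopologicalSpace Y]
    [T2Space Y] [TopologicalSpace Z] {f : X → Y} {K : Set X} (hK : IsCompact K)
    (hf : ContinuousOn f K) (hinj : InjOn f K) {g : Z → Y} (hg : Continuous g)
    (hgK : ∀ z, g z ∈ f '' K) :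
    ∃ s : Z → X, Continuous s ∧ ∀ z, s z ∈ K ∧ f (s z) = g z := by
  have : CompactSpace K := isCompact_iff_compactSpace.mp hK
  have hcont : Continuous fun x : K => f x := continuousOn_iff_continuous_domRestrict.mp hf
  have hemb : IsClosedEmbedding fun x : K => f x :=
    hcont.isClosedEmbedding fun x y h => Subtype.ext (hinj x.2 y.2 h)
  choose s hsK hs using hgK
  refine ⟨s, ?_, fun z => ⟨hsK z, hs z⟩⟩
  have : Continuous fun z => (⟨s z, hsK z⟩ : K) :=
    hemb.isInducing.continuous_iff.mpr (by simpa [Function.comp_def, hs] using hg)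
  exact continuous_subtype_val.comp this

open Set in
/-- The closure of a Jordan disk missing a point on each side of a circle cannot contain that
circle. -/
theorem exists_circleParam_notMem_closure
    (b : OrthonormalBasis (Fin 3) ℝ (EuclideanSpace ℝ (Fin 3)))
    {p q : EuclideanSpace ℝ (Fin 3)} (hp : p ∈ S2) (hq : q ∈ S2) {r c : ℝ} (hr : 0 < r)
    (h : r ^ 2 + c ^ 2 = 1) (hpc : ⟪b 2, p⟫ < c) (hqc : c < ⟪b 2, q⟫)
    {D : Set (EuclideanSpace ℝ (Fin 3))} (hD : IsJordanDisk D) (hpD : p ∉ D) (hqD : q ∉ D) :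
    ∃ t, circleParam b r c t ∉ closure D := by
  by_contra! hcl
  obtain ⟨hDS, -, f, hf, hinj, hfcl, hfD⟩ := hD
  obtain ⟨w, hw, hcirc⟩ := exists_lineProj_circleParam_eq b hp hq hr h hpc hqc
  obtain ⟨s, hs, hsf⟩ := exists_continuous_lift_of_injOn (isCompact_closedBall (0 : ℂ) 1) hf hinj
    (continuous_circleParam b r c) (fun t => hfcl.symm ▸ hcl t)
  have hS : closure D ⊆ S2 := closure_minimal hDS Metric.isClosed_sphere
  set κ : ℝ → ℝ := fun x => max 0 (min 1 x) with hκ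
  have hκc : Continuous κ := by fun_prop
  have hκ0 : ∀ x, 0 ≤ κ x := fun x => le_max_left _ _
  have hκ1 : ∀ x, κ x ≤ 1 := fun x => max_le zero_le_one (min_le_left _ _)
  have hnorm : ∀ x t, ‖κ x • s t‖ = κ x * ‖s t‖ := fun x t => by
    rw [norm_smul, Real.norm_of_nonneg (hκ0 x)]
  have hs1 : ∀ t, ‖s t‖ ≤ 1 := fun t => mem_closedBall_zero_iff.mp (hsf t).1
  have hball : ∀ x t, κ x • s t ∈ Metric.closedBall (0 : ℂ) 1 := fun x t => by
    rw [mem_closedBall_zero_iff, hnorm]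
    exact mul_le_one₀ (hκ1 x) (norm_nonneg _) (hs1 t)
  have havoid : ∀ y ∉ D, ⟪b 2, y⟫ ≠ c → ∀ x t, f (κ x • s t) ≠ y := by
    rintro y hyD hyc x t rfl
    have hnb : ¬ ‖κ x • s t‖ < 1 := fun hlt =>
      hyD (hfD ▸ mem_image_of_mem f (mem_ball_zero_iff.mpr hlt))
    have hx1 : κ x = 1 := by
      refine le_antisymm (hκ1 x) ?_
      rw [hnorm] at hnb
      nlinarith [hκ0 x, hs1 t]
    rw [hx1, one_smul, (hsf t).2] at hyc
    exact hyc (inner_circleParam b r c t).2.2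
  have hsper : s (2 * Real.pi) = s 0 := hinj (hsf _).1 (hsf _).1 (by
    rw [(hsf _).2, (hsf _).2]; simp [circleParam])
  refine not_nullhomotopic_circle hw (H := fun y => lineProj b p q (f (κ y.1 • s y.2))) ?_ ?_ ?_ ?_
    ?_
  · exact (continuous_lineProj b p q).comp
      (hf.comp_continuous (by fun_prop) fun y => hball y.1 y.2)
  · intro y hy
    rcases eq_or_eq_of_lineProj_eq_zero b hp hq
      (hS (hfcl ▸ mem_image_of_mem f (hball y.1 y.2))) (hpc.trans hqc) hy with h | h
    · exact havoid p hpD hpc.ne _ _ h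
    · exact havoid q hqD hqc.ne' _ _ h
  · intro x
    simp only [hsper]
  · intro t
    simp [hκ]
  · intro t
    simp [hκ, (hsf t).2, hcirc]

theorem exists_orthonormalBasis_smul_eq {v : EuclideanSpace ℝ (Fin 3)} (hv : v ≠ 0) :
    ∃ b : OrthonormalBasis (Fin 3) ℝ (EuclideanSpace ℝ (Fin 3)), v = ‖v‖ • b 2 := by
  have hv' : ‖v‖ ≠ 0 := norm_ne_zero_iff.mpr hv
  obtain ⟨b, hb⟩ := Orthonormal.exists_orthonormalBasis_extension_of_card_eq (𝕜 := ℝ)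
    (E := EuclideanSpace ℝ (Fin 3)) (ι := Fin 3) (by simp) (v := fun _ => ‖v‖⁻¹ • v) (s := {2})
    ⟨fun _ => by simp [norm_smul, hv'], fun i j hij => (hij (Subsingleton.elim i j)).elim⟩
  refine ⟨b, ?_⟩
  rw [hb 2 rfl, smul_inv_smul₀ hv']

/-- If `Λ ⊆ S²` is a Sierpiński curve and `C = S² ∩ P` is a circle such that both open
half-spaces bounded by the plane `P` meet `Λ`, then `C ∩ Λ` contains a Cantor set;
in particular `C ∩ Λ` is uncountable. -/
theorem circle_slice_contains_cantor_set
    (Λ : Set (EuclideanSpace ℝ (Fin 3))) (hΛcpt : IsCompact Λ) (hΛsub : Λ ⊆ S2)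
    (D : ℕ → Set (EuclideanSpace ℝ (Fin 3)))
    (hJordan : ∀ n, IsJordanDisk (D n))
    (hdisj : ∀ m n, m ≠ n → Disjoint (closure (D m)) (closure (D n)))
    (hdiam : Filter.Tendsto (fun n => Metric.diam (D n)) Filter.atTop (nhds 0))
    (hcompl : S2 \ Λ = ⋃ n, D n)
    (hdense : S2 ⊆ closure (⋃ n, D n))
    (v : EuclideanSpace ℝ (Fin 3)) (hv : v ≠ 0) (c : ℝ)
    (hbelow : ∃ x ∈ Λ, ⟪v, x⟫ < c) (habove : ∃ x ∈ Λ, c < ⟪v, x⟫) :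
    (∃ K ⊆ (S2 ∩ {x | ⟪v, x⟫ = c}) ∩ Λ, IsCantorSet K) ∧
      ¬ ((S2 ∩ {x | ⟪v, x⟫ = c}) ∩ Λ).Countable := by
  have huncount : ¬ ((S2 ∩ {x | ⟪v, x⟫ = c}) ∩ Λ).Countable := by
    intro hcount
    obtain ⟨p, hpΛ, hp⟩ := hbelow
    obtain ⟨q, hqΛ, hq⟩ := habove
    obtain ⟨b, hb⟩ := exists_orthonormalBasis_smul_eq hv
    have hv0 : 0 < ‖v‖ := norm_pos_iff.mpr hv
    have hinner : ∀ x, ⟪v, x⟫ = ‖v‖ * ⟪b 2, x⟫ := fun x => by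
      conv_lhs => rw [hb]
      rw [real_inner_smul_left]
    obtain ⟨e, rfl⟩ : ∃ e, c = ‖v‖ * e := ⟨c / ‖v‖, by field_simp⟩
    rw [hinner, mul_lt_mul_iff_right₀ hv0] at hp hq
    have hp1 := sum_sq_inner_of_mem_S2 b (hΛsub hpΛ)
    have hq1 := sum_sq_inner_of_mem_S2 b (hΛsub hqΛ)
    have he : 0 < 1 - e ^ 2 := by
      have h1 : -1 ≤ ⟪b 2, p⟫ := by nlinarith [sq_nonneg ⟪b 0, p⟫, sq_nonneg ⟪b 1, p⟫]
      have h2 : ⟪b 2, q⟫ ≤ 1 := by nlinarith [sq_nonneg ⟪b 0, q⟫, sq_nonneg ⟪b 1, q⟫]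
      nlinarith
    have hr : 0 < Real.sqrt (1 - e ^ 2) := Real.sqrt_pos.mpr he
    have hre : Real.sqrt (1 - e ^ 2) ^ 2 + e ^ 2 = 1 := by rw [Real.sq_sqrt he.le]; ring
    set γ := circleParam b (Real.sqrt (1 - e ^ 2)) e with hγ
    have hγc : Continuous γ := continuous_circleParam b _ _
    have hγS : ∀ t, γ t ∈ S2 := circleParam_mem_S2 b hre
    have hγi : ∀ t, ⟪v, γ t⟫ = ‖v‖ * e := fun t => by
      rw [hinner, (inner_circleParam b _ e t).2.2]
    have hnot : ∀ n x, x ∈ Λ → x ∉ D n := fun n x hx hxD =>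
      (hcompl.ge (Set.mem_iUnion.mpr ⟨n, hxD⟩)).2 hx
    let E : Set (EuclideanSpace ℝ (Fin 3)) :=
      ((S2 ∩ {x | ⟪v, x⟫ = ‖v‖ * e}) ∩ Λ) \ ⋃ n, closure (D n)
    have hE : Countable E := (hcount.mono Set.sdiff_subset).to_subtype
    let G : ℕ ⊕ E → Set (EuclideanSpace ℝ (Fin 3)) :=
      Sum.elim (fun n => closure (D n)) (fun x => {(x : EuclideanSpace ℝ (Fin 3))})
    have hGdisj : ∀ i j, i ≠ j → Disjoint (G i) (G j) := by
      have hmix : ∀ n (x : E), Disjoint (closure (D n)) {(x : EuclideanSpace ℝ (Fin 3))} :=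
        fun n x => Set.disjoint_singleton_right.mpr fun h => x.2.2 (Set.mem_iUnion.mpr ⟨n, h⟩)
      rintro (m | x) (n | y) hij
      · exact hdisj m n fun h => hij (congrArg _ h)
      · exact hmix m y
      · exact (hmix n x).symm
      · exact Set.disjoint_singleton.mpr fun h => hij (congrArg _ (Subtype.ext h))
    have hGclosed : ∀ i, IsClosed (G i) := by
      rintro (n | x)
      · exact isClosed_closure
      · exact isClosed_singleton
    have hGcov : ∀ t, ∃ i, γ t ∈ G i := by
      intro t
      by_cases h : γ t ∈ ⋃ n, closure (D n)
      · obtain ⟨n, hn⟩ := Set.mem_iUnion.mp h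
        exact ⟨Sum.inl n, hn⟩
      · have hΛt : γ t ∈ Λ := by
          by_contra hΛt
          obtain ⟨n, hn⟩ := Set.mem_iUnion.mp (hcompl.le ⟨hγS t, hΛt⟩)
          exact h (Set.mem_iUnion.mpr ⟨n, subset_closure hn⟩)
        exact ⟨Sum.inr ⟨γ t, ⟨⟨hγS t, hγi t⟩, hΛt⟩, h⟩, rfl⟩
    obtain ⟨i, hi⟩ := exists_eq_univ_of_iUnion_isClosed_eq_univ (F := fun i => γ ⁻¹' G i)
      (fun i => (hGclosed i).preimage hγc) (fun i j hij => (hGdisj i j hij).preimage γ)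
      (Set.iUnion_eq_univ_iff.mpr hGcov)
    have hi' : ∀ t, γ t ∈ G i := fun t => hi.ge (Set.mem_univ t)
    rcases i with n | x
    · obtain ⟨t, ht⟩ := exists_circleParam_notMem_closure b (hΛsub hpΛ) (hΛsub hqΛ) hr hre hp hq
        (hJordan n) (hnot n p hpΛ) (hnot n q hqΛ)
      exact ht (hi' t)
    · have h0 : γ 0 = γ Real.pi := (hi' 0 : γ 0 = x).trans (hi' Real.pi : γ Real.pi = x).symm
      have h1 := (inner_circleParam b (Real.sqrt (1 - e ^ 2)) e 0).1
      have h2 := (inner_circleParam b (Real.sqrt (1 - e ^ 2)) e Real.pi).1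
      rw [← hγ, h0, h2, Real.cos_zero, Real.cos_pi] at h1
      linarith
  refine ⟨?_, huncount⟩
  have hclosed : IsClosed ((S2 ∩ {x | ⟪v, x⟫ = c}) ∩ Λ) :=
    (Metric.isClosed_sphere.inter (isClosed_eq (by fun_prop) continuous_const)).inter
      hΛcpt.isClosed
  obtain ⟨f, hfsub, hf, hinj⟩ := hclosed.exists_nat_bool_injection_of_not_countable huncount
  exact ⟨Set.range f, hfsub, isCantorSet_range hf hinj⟩
end

section
/- Let C = {z ∈ ℂ : |z| = 1} be the unit circle. Let (U_n)_{n∈ℕ} be open subsets of C such that the closures of the U_n are pairwise disjoint, diam(U_n) → 0, ⋃_n U_n is dense in C, and no single U_n is dense in C. Then there exists a sequence (I_k)_{k∈ℕ} of nonempty connected open subsets of C such that: (a) the closure of each I_k is a proper subset of C; (b) the closures of the I_k are pairwise disjoint; (c) for each k there exists an index n(k) such that the frontier of I_k is contained in the frontier of U_{n(k)}; (d) ⋃_k I_k is dense in C; and (e) the set K = C \ ⋃_k I_k is a Cantor set disjoint from ⋃_n U_n. -/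
/-- The unit circle in `ℂ`, as a topological (metric) space. -/
abbrev UnitCircle : Type := ↥(Metric.sphere (0 : ℂ) 1)

open Set Topology

namespace Bridge

/-- The least `m` such that `V m` meets the interval `(x, y)`. -/
noncomputable def firstIndex (V : ℕ → Set ℝ) (x y : ℝ) : ℕ :=
  sInf {m | (V m ∩ Ioo x y).Nonempty}

/-- The trace on `(x, y)` of the first `V m` meeting it. -/
def firstTrace (V : ℕ → Set ℝ) (x y : ℝ) : Set ℝ :=
  V (firstIndex V x y) ∩ Ioo x y

/-- Left endpoint of the convex hull of `firstTrace V x y`. -/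
noncomputable def lo (V : ℕ → Set ℝ) (x y : ℝ) : ℝ := sInf (firstTrace V x y)

/-- Right endpoint of the convex hull of `firstTrace V x y`. -/
noncomputable def hi (V : ℕ → Set ℝ) (x y : ℝ) : ℝ := sSup (firstTrace V x y)

/-- Endpoints of the bridge reached from the gap `(x, y)` by following a binary word: at each
letter, move to the gap on the left or on the right of the hull of the first trace. -/
noncomputable def bridge (V : ℕ → Set ℝ) : List Bool → ℝ → ℝ → ℝ × ℝ
  | [], x, y => (lo V x y, hi V x y)
  | false :: w, x, y => bridge V w x (lo V x y)
  | true :: w, x, y => bridge V w (hi V x y) y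

/-- A nondegenerate interval none of whose endpoints is a limit of the part of some `V m` inside
the interval. -/
structure IsGap (V : ℕ → Set ℝ) (x y : ℝ) : Prop where
  lt : x < y
  left : ∀ m, x ∉ closure (V m ∩ Ioo x y)
  right : ∀ m, y ∉ closure (V m ∩ Ioo x y)

/-- Open sets of reals with pairwise disjoint closures and dense union. -/
structure IsAdmissible (V : ℕ → Set ℝ) : Prop where
  isOpen : ∀ n, IsOpen (V n)
  disjoint : ∀ m n, m ≠ n → Disjoint (closure (V m)) (closure (V n))
  dense : Dense (⋃ n, V n)

variable {V : ℕ → Set ℝ} {x y : ℝ}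

lemma csInf_notMem_of_isOpen {s : Set ℝ} (hs : IsOpen s) (hb : BddBelow s) : sInf s ∉ s := by
  intro h
  obtain ⟨l, hl, hls⟩ := exists_Ioc_subset_of_mem_nhds (hs.mem_nhds h) (exists_lt _)
  obtain ⟨z, hz⟩ := exists_between hl
  exact (csInf_le hb (hls ⟨hz.1, hz.2.le⟩)).not_gt hz.2

lemma csSup_notMem_of_isOpen {s : Set ℝ} (hs : IsOpen s) (hb : BddAbove s) : sSup s ∉ s := by
  intro h
  obtain ⟨l, hl, hls⟩ := exists_Ico_subset_of_mem_nhds (hs.mem_nhds h) (exists_gt _)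
  obtain ⟨z, hz⟩ := exists_between hl
  exact (le_csSup hb (hls ⟨hz.1.le, hz.2⟩)).not_gt hz.1

lemma bddBelow_firstTrace : BddBelow (firstTrace V x y) :=
  bddBelow_Ioo.mono inter_subset_right

lemma bddAbove_firstTrace : BddAbove (firstTrace V x y) :=
  bddAbove_Ioo.mono inter_subset_right

lemma inter_eq_empty_of_lt_firstIndex {m : ℕ} (hm : m < firstIndex V x y) :
    V m ∩ Ioo x y = ∅ :=
  not_nonempty_iff_eq_empty.1 (Nat.notMem_of_lt_sInf hm)

lemma IsAdmissible.notMem (hV : IsAdmissible V) {m n : ℕ} {z : ℝ} (h : z ∈ closure (V m))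
    (hz : z ∉ V m) : z ∉ V n := by
  intro hn
  rcases eq_or_ne m n with rfl | hmn
  · exact hz hn
  · exact (hV.disjoint m n hmn).le_bot ⟨h, subset_closure hn⟩

lemma firstTrace_nonempty (hV : IsAdmissible V) (h : x < y) : (firstTrace V x y).Nonempty := by
  obtain ⟨z, hz, hzV⟩ := hV.dense.exists_mem_open isOpen_Ioo (nonempty_Ioo.2 h)
  obtain ⟨n, hn⟩ := mem_iUnion.1 hz
  exact Nat.sInf_mem (s := {m | (V m ∩ Ioo x y).Nonempty}) ⟨n, z, hn, hzV⟩

lemma isOpen_firstTrace (hV : IsAdmissible V) : IsOpen (firstTrace V x y) :=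
  (hV.isOpen _).inter isOpen_Ioo

lemma lo_mem_closure (hV : IsAdmissible V) (h : x < y) : lo V x y ∈ closure (firstTrace V x y) :=
  csInf_mem_closure (firstTrace_nonempty hV h) bddBelow_firstTrace

lemma hi_mem_closure (hV : IsAdmissible V) (h : x < y) : hi V x y ∈ closure (firstTrace V x y) :=
  csSup_mem_closure (firstTrace_nonempty hV h) bddAbove_firstTrace

lemma IsGap.lt_lo (hV : IsAdmissible V) (h : IsGap V x y) : x < lo V x y := by
  refine lt_of_le_of_ne (le_csInf (firstTrace_nonempty hV h.lt) fun z hz => hz.2.1.le) ?_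
  intro he
  have := lo_mem_closure hV h.lt
  rw [← he] at this
  exact h.left _ this

lemma IsGap.hi_lt (hV : IsAdmissible V) (h : IsGap V x y) : hi V x y < y := by
  refine lt_of_le_of_ne (csSup_le (firstTrace_nonempty hV h.lt) fun z hz => hz.2.2.le) ?_
  intro he
  have := hi_mem_closure hV h.lt
  rw [he] at this
  exact h.right _ this

lemma lo_lt_of_mem (hV : IsAdmissible V) {t : ℝ} (ht : t ∈ firstTrace V x y) : lo V x y < t :=
  lt_of_le_of_ne (csInf_le bddBelow_firstTrace ht) fun he =>
    csInf_notMem_of_isOpen (isOpen_firstTrace hV) bddBelow_firstTrace (he ▸ ht)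

lemma lt_hi_of_mem (hV : IsAdmissible V) {t : ℝ} (ht : t ∈ firstTrace V x y) : t < hi V x y :=
  lt_of_le_of_ne (le_csSup bddAbove_firstTrace ht) fun he =>
    csSup_notMem_of_isOpen (isOpen_firstTrace hV) bddAbove_firstTrace (he ▸ ht)

lemma lo_lt_hi (hV : IsAdmissible V) (h : x < y) : lo V x y < hi V x y := by
  obtain ⟨t, ht⟩ := firstTrace_nonempty hV h
  exact (lo_lt_of_mem hV ht).trans (lt_hi_of_mem hV ht)

lemma IsGap.lo_mem_frontier (hV : IsAdmissible V) (h : IsGap V x y) :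
    lo V x y ∈ frontier (V (firstIndex V x y)) := by
  rw [(hV.isOpen _).frontier_eq]
  refine ⟨closure_mono inter_subset_left (lo_mem_closure hV h.lt), fun hm => ?_⟩
  exact csInf_notMem_of_isOpen (isOpen_firstTrace hV) bddBelow_firstTrace
    ⟨hm, h.lt_lo hV, (lo_lt_hi hV h.lt).trans (h.hi_lt hV)⟩

lemma IsGap.hi_mem_frontier (hV : IsAdmissible V) (h : IsGap V x y) :
    hi V x y ∈ frontier (V (firstIndex V x y)) := by
  rw [(hV.isOpen _).frontier_eq]
  refine ⟨closure_mono inter_subset_left (hi_mem_closure hV h.lt), fun hm => ?_⟩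
  exact csSup_notMem_of_isOpen (isOpen_firstTrace hV) bddAbove_firstTrace
    ⟨hm, (h.lt_lo hV).trans (lo_lt_hi hV h.lt), h.hi_lt hV⟩

lemma IsGap.inter_Ioo_lo (hV : IsAdmissible V) (h : IsGap V x y) :
    V (firstIndex V x y) ∩ Ioo x (lo V x y) = ∅ := by
  rw [eq_empty_iff_forall_notMem]
  rintro t ⟨ht, h1, h2⟩
  exact h2.not_gt
    (lo_lt_of_mem hV ⟨ht, h1, h2.trans ((lo_lt_hi hV h.lt).trans (h.hi_lt hV))⟩)

lemma IsGap.inter_Ioo_hi (hV : IsAdmissible V) (h : IsGap V x y) :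
    V (firstIndex V x y) ∩ Ioo (hi V x y) y = ∅ := by
  rw [eq_empty_iff_forall_notMem]
  rintro t ⟨ht, h1, h2⟩
  exact h1.not_gt
    (lt_hi_of_mem hV ⟨ht, ((h.lt_lo hV).trans (lo_lt_hi hV h.lt)).trans h1, h2⟩)

lemma Ioo_lo_subset (hV : IsAdmissible V) (h : IsGap V x y) : Ioo x (lo V x y) ⊆ Ioo x y :=
  Ioo_subset_Ioo_right ((lo_lt_hi hV h.lt).trans (h.hi_lt hV)).le

lemma Ioo_hi_subset (hV : IsAdmissible V) (h : IsGap V x y) : Ioo (hi V x y) y ⊆ Ioo x y :=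
  Ioo_subset_Ioo_left ((h.lt_lo hV).trans (lo_lt_hi hV h.lt)).le

lemma notMem_closure_inter (hV : IsAdmissible V) {n : ℕ} {s : Set ℝ} {z : ℝ}
    (hz : z ∈ frontier (V n)) (hs : V n ∩ s = ∅) (m : ℕ) : z ∉ closure (V m ∩ s) := by
  rcases eq_or_ne n m with rfl | hnm
  · simp [hs]
  · exact fun h => (hV.disjoint n m hnm).le_bot
      ⟨frontier_subset_closure hz, closure_mono inter_subset_left h⟩

lemma IsGap.lo_gap (hV : IsAdmissible V) (h : IsGap V x y) : IsGap V x (lo V x y) where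
  lt := h.lt_lo hV
  left m hm := h.left m (closure_mono (inter_subset_inter_right _ (Ioo_lo_subset hV h)) hm)
  right := notMem_closure_inter hV (h.lo_mem_frontier hV) (h.inter_Ioo_lo hV)

lemma IsGap.hi_gap (hV : IsAdmissible V) (h : IsGap V x y) : IsGap V (hi V x y) y where
  lt := h.hi_lt hV
  left := notMem_closure_inter hV (h.hi_mem_frontier hV) (h.inter_Ioo_hi hV)
  right m hm := h.right m (closure_mono (inter_subset_inter_right _ (Ioo_hi_subset hV h)) hm)

/-- Every bridge is a nondegenerate interval compactly contained in the gap it starts from, with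
both endpoints on the frontier of a common `V n`. -/
lemma bridge_spec (hV : IsAdmissible V) (w : List Bool) (h : IsGap V x y) :
    x < (bridge V w x y).1 ∧ (bridge V w x y).1 < (bridge V w x y).2 ∧ (bridge V w x y).2 < y ∧
      ∃ n, (bridge V w x y).1 ∈ frontier (V n) ∧ (bridge V w x y).2 ∈ frontier (V n) := by
  induction w generalizing x y with
  | nil =>
    exact ⟨h.lt_lo hV, lo_lt_hi hV h.lt, h.hi_lt hV, _, h.lo_mem_frontier hV,
      h.hi_mem_frontier hV⟩
  | cons b w ih =>
    cases b
    · obtain ⟨h1, h2, h3, h4⟩ := ih (h.lo_gap hV)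
      exact ⟨h1, h2, h3.trans ((lo_lt_hi hV h.lt).trans (h.hi_lt hV)), h4⟩
    · obtain ⟨h1, h2, h3, h4⟩ := ih (h.hi_gap hV)
      exact ⟨((h.lt_lo hV).trans (lo_lt_hi hV h.lt)).trans h1, h2, h3, h4⟩

lemma disjoint_Icc_of_lt {a b c d : ℝ} (h : b < c) : Disjoint (Icc a b) (Icc c d) :=
  Set.disjoint_left.2 fun _ h1 h2 => (h1.2.trans_lt h).not_ge h2.1

lemma bridge_disjoint (hV : IsAdmissible V) (w w' : List Bool) (hw : w ≠ w') (h : IsGap V x y) :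
    Disjoint (Icc (bridge V w x y).1 (bridge V w x y).2)
      (Icc (bridge V w' x y).1 (bridge V w' x y).2) := by
  have hl := fun w => bridge_spec hV w (h.lo_gap hV)
  have hr := fun w => bridge_spec hV w (h.hi_gap hV)
  induction w generalizing x y w' with
  | nil =>
    rcases w' with _ | ⟨_ | _, w'⟩
    · exact absurd rfl hw
    · exact (disjoint_Icc_of_lt (hl w').2.2.1).symm
    · exact disjoint_Icc_of_lt (hr w').1
  | cons b w ih =>
    rcases w' with _ | ⟨b', w'⟩
    · cases b
      · exact disjoint_Icc_of_lt (hl w).2.2.1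
      · exact (disjoint_Icc_of_lt (hr w).1).symm
    · have hlt := lo_lt_hi hV h.lt
      cases b <;> cases b'
      · exact ih w' (by simpa using hw) (h.lo_gap hV)
          (fun w => bridge_spec hV w ((h.lo_gap hV).lo_gap hV))
          (fun w => bridge_spec hV w ((h.lo_gap hV).hi_gap hV))
      · exact disjoint_Icc_of_lt ((hl w).2.2.1.trans (hlt.trans (hr w').1))
      · exact (disjoint_Icc_of_lt ((hl w').2.2.1.trans (hlt.trans (hr w).1))).symm
      · exact ih w' (by simpa using hw) (h.hi_gap hV)
          (fun w => bridge_spec hV w ((h.hi_gap hV).lo_gap hV))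
          (fun w => bridge_spec hV w ((h.hi_gap hV).hi_gap hV))

lemma exists_mem_bridge_of_add_lt (hV : IsAdmissible V) {n : ℕ} {t : ℝ} (ht : t ∈ V n) (k : ℕ)
    (h : IsGap V x y) (htxy : t ∈ Ioo x y) (hk : ∀ j, j + k < n → V j ∩ Ioo x y = ∅) :
    ∃ w, t ∈ Ioo (bridge V w x y).1 (bridge V w x y).2 := by
  induction k generalizing x y with
  | zero =>
    have h1 : firstIndex V x y ≤ n := Nat.sInf_le ⟨t, ht, htxy⟩
    have h2 : firstIndex V x y = n := by
      refine h1.antisymm (not_lt.1 fun hlt => ?_)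
      exact (firstTrace_nonempty hV h.lt).ne_empty (hk _ hlt)
    have h3 : t ∈ firstTrace V x y := ⟨h2 ▸ ht, htxy⟩
    exact ⟨[], lo_lt_of_mem hV h3, lt_hi_of_mem hV h3⟩
  | succ k ih =>
    have hm : n ≤ firstIndex V x y + (k + 1) := not_lt.1 fun hlt =>
      (firstTrace_nonempty hV h.lt).ne_empty (hk _ hlt)
    have key : ∀ s ⊆ Ioo x y, V (firstIndex V x y) ∩ s = ∅ → ∀ j, j + k < n → V j ∩ s = ∅ := by
      intro s hs hse j hj
      rcases lt_trichotomy j (firstIndex V x y) with hlt | rfl | hgt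
      · exact subset_eq_empty (inter_subset_inter_right _ hs)
          (inter_eq_empty_of_lt_firstIndex hlt)
      · exact hse
      · omega
    have hlo := h.lo_mem_frontier hV
    have hhi := h.hi_mem_frontier hV
    rw [(hV.isOpen _).frontier_eq] at hlo hhi
    rcases lt_trichotomy t (lo V x y) with hlt | rfl | hgt
    · obtain ⟨w, hw⟩ := ih (h.lo_gap hV) ⟨htxy.1, hlt⟩
        (key _ (Ioo_lo_subset hV h) (h.inter_Ioo_lo hV))
      exact ⟨false :: w, hw⟩
    · exact absurd ht (hV.notMem hlo.1 hlo.2)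
    · rcases lt_trichotomy t (hi V x y) with hlt' | rfl | hgt'
      · exact ⟨[], hgt, hlt'⟩
      · exact absurd ht (hV.notMem hhi.1 hhi.2)
      · obtain ⟨w, hw⟩ := ih (h.hi_gap hV) ⟨hgt', htxy.2⟩
          (key _ (Ioo_hi_subset hV h) (h.inter_Ioo_hi hV))
        exact ⟨true :: w, hw⟩

lemma exists_mem_bridge (hV : IsAdmissible V) {n : ℕ} {t : ℝ} (ht : t ∈ V n)
    (h : IsGap V x y) (htxy : t ∈ Ioo x y) :
    ∃ w, t ∈ Ioo (bridge V w x y).1 (bridge V w x y).2 :=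
  exists_mem_bridge_of_add_lt hV ht n h htxy fun _ hj => absurd hj (by omega)

section Complement

variable {ι : Type*} {c d : ι → ℝ} {a b : ℝ}

lemma exists_left_endpoint_eq
    (hdisj : ∀ i j, i ≠ j → Disjoint (Icc (c i) (d i)) (Icc (c j) (d j)))
    (hxy : x < y) (hcov : Ioo x y ⊆ ⋃ i, Ioo (c i) (d i)) (hx : x ∉ ⋃ i, Ioo (c i) (d i)) :
    ∃ i, c i = x := by
  obtain ⟨z, hz⟩ := exists_between hxy
  obtain ⟨i, hi⟩ := mem_iUnion.1 (hcov hz)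
  refine ⟨i, le_antisymm (not_lt.1 fun hlt => ?_) (not_lt.1 fun hlt => ?_)⟩
  · obtain ⟨j, hj⟩ := mem_iUnion.1 (hcov ⟨hlt, hi.1.trans hz.2⟩)
    rcases eq_or_ne i j with rfl | hij
    · exact lt_irrefl _ hj.1
    · exact (hdisj i j hij).le_bot
        ⟨left_mem_Icc.2 (hi.1.trans hi.2).le, Ioo_subset_Icc_self hj⟩
  · exact hx (mem_iUnion.2 ⟨i, hlt, hz.1.trans hi.2⟩)

lemma exists_right_endpoint_eq
    (hdisj : ∀ i j, i ≠ j → Disjoint (Icc (c i) (d i)) (Icc (c j) (d j)))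
    (hxy : x < y) (hcov : Ioo x y ⊆ ⋃ i, Ioo (c i) (d i)) (hy : y ∉ ⋃ i, Ioo (c i) (d i)) :
    ∃ i, d i = y := by
  obtain ⟨z, hz⟩ := exists_between hxy
  obtain ⟨i, hi⟩ := mem_iUnion.1 (hcov hz)
  refine ⟨i, le_antisymm (not_lt.1 fun hlt => ?_) (not_lt.1 fun hlt => ?_)⟩
  · exact hy (mem_iUnion.2 ⟨i, hi.1.trans hz.2, hlt⟩)
  · obtain ⟨j, hj⟩ := mem_iUnion.1 (hcov ⟨hz.1.trans hi.2, hlt⟩)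
    rcases eq_or_ne i j with rfl | hij
    · exact lt_irrefl _ hj.2
    · exact (hdisj i j hij).le_bot
        ⟨right_mem_Icc.2 (hi.1.trans hi.2).le, Ioo_subset_Icc_self hj⟩

/-- Removing from `[a, b]` a family of open intervals with pairwise disjoint closures inside
`(a, b)` leaves no isolated point. -/
lemma preperfect_Icc_diff (hab : a < b) (hac : ∀ i, a < c i) (hcd : ∀ i, c i < d i)
    (hdb : ∀ i, d i < b)
    (hdisj : ∀ i j, i ≠ j → Disjoint (Icc (c i) (d i)) (Icc (c j) (d j))) :
    Preperfect (Icc a b \ ⋃ i, Ioo (c i) (d i)) := by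
  rintro x ⟨hx, hxU⟩
  rw [accPt_iff_nhds]
  by_contra! hcon
  obtain ⟨N, hN, hiso⟩ := hcon
  obtain ⟨l, u, ⟨hl, hu⟩, hlu⟩ := mem_nhds_iff_exists_Ioo_subset.1 hN
  have hcov : ∀ z ∈ Ioo l u, z ∈ Icc a b → z ≠ x → z ∈ ⋃ i, Ioo (c i) (d i) := by
    intro z hz hzab hne
    by_contra hzU
    exact hne (hiso z ⟨hlu hz, hzab, hzU⟩)
  have hright : x < b → ∃ i, c i = x := fun hxb =>
    exists_left_endpoint_eq hdisj (lt_min hu hxb) (fun z hz => hcov z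
      ⟨hl.trans hz.1, hz.2.trans_le (min_le_left _ _)⟩
      ⟨hx.1.trans hz.1.le, (hz.2.trans_le (min_le_right _ _)).le⟩ hz.1.ne') hxU
  have hleft : a < x → ∃ i, d i = x := fun hax =>
    exists_right_endpoint_eq hdisj (max_lt hl hax) (fun z hz => hcov z
      ⟨(le_max_left _ _).trans_lt hz.1, hz.2.trans hu⟩
      ⟨((le_max_right _ _).trans_lt hz.1).le, hz.2.le.trans hx.2⟩ hz.2.ne) hxU
  rcases hx.1.eq_or_lt with rfl | hax
  · obtain ⟨i, hi⟩ := hright hab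
    exact (hac i).ne' hi
  rcases hx.2.eq_or_lt with rfl | hxb
  · obtain ⟨i, hi⟩ := hleft hab
    exact (hdb i).ne hi
  obtain ⟨i, hi⟩ := hright hxb
  obtain ⟨j, hj⟩ := hleft hax
  rcases eq_or_ne i j with rfl | hij
  · exact (hcd i).ne (hi.trans hj.symm)
  · refine (hdisj i j hij).le_bot ⟨left_mem_Icc.2 (hcd i).le, ?_⟩
    rw [hi, ← hj]
    exact right_mem_Icc.2 (hcd j).le

end Complement

lemma isTotallyDisconnected_of_dense_compl {s : Set ℝ} (hs : Dense sᶜ) :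
    IsTotallyDisconnected s := by
  have key : ∀ t ⊆ s, IsPreconnected t → ∀ x ∈ t, ∀ y ∈ t, ¬ x < y := by
    intro t hts ht x hx y hy hxy
    obtain ⟨z, hz, hzI⟩ := hs.exists_mem_open isOpen_Ioo (nonempty_Ioo.2 hxy)
    exact hz (hts (ht.Icc_subset hx hy (Ioo_subset_Icc_self hzI)))
  intro t hts ht x hx y hy
  exact le_antisymm (not_lt.1 (key t hts ht y hy x hx)) (not_lt.1 (key t hts ht x hx y hy))

lemma _root_.Preperfect.image {X Y : Type*} [TopologicalSpace X] [TopologicalSpace Y] {f : X → Y}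
    {s : Set X} (hs : Preperfect s) (hf : Continuous f) (hinj : Function.Injective f) :
    Preperfect (f '' s) := by
  rintro _ ⟨x, hx, rfl⟩
  simpa using (hs x hx).map hf.continuousAt hinj

/-- The circle minus a point is an open topological line. -/
lemma exists_isOpenEmbedding_range_eq_compl (p : UnitCircle) :
    ∃ φ : ℝ → UnitCircle, IsOpenEmbedding φ ∧ range φ = {p}ᶜ := by
  have : Fact (Module.finrank ℝ ℂ = 1 + 1) := Complex.finrank_real_complex_fact
  let g : ℝ ≃ₜ EuclideanSpace ℝ (Fin 1) :=
    (Homeomorph.funUnique (Fin 1) ℝ).symm.trans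
      (EuclideanSpace.equiv (Fin 1) ℝ).symm.toHomeomorph
  let e := (stereographic' 1 p).symm
  have hsrc : e.source = univ := stereographic'_target p
  refine ⟨e ∘ g, (e.isOpenEmbedding hsrc).comp g.isOpenEmbedding, ?_⟩
  rw [range_comp, g.surjective.range_eq, ← hsrc, e.image_source_eq_target]
  exact stereographic'_source p

section Line

variable {φ : ℝ → UnitCircle} {p : UnitCircle}

lemma mem_closure_image (hφ : IsOpenEmbedding φ) (hr : range φ = {p}ᶜ) {s : Set ℝ}
    (hs : ∀ K, IsCompact K → ¬ s ⊆ K) : p ∈ closure (φ '' s) := by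
  by_contra hp
  have hsub : closure (φ '' s) ⊆ range φ := by
    rw [hr]
    rintro _ hz rfl
    exact hp hz
  refine hs _ ((hφ.isInducing.isCompact_preimage_iff hsub).2 isClosed_closure.isCompact) ?_
  exact image_subset_iff.1 subset_closure

lemma mem_closure_image_Iio (hφ : IsOpenEmbedding φ) (hr : range φ = {p}ᶜ) (a : ℝ) :
    p ∈ closure (φ '' Iio a) :=
  mem_closure_image hφ hr fun _ hK hs => not_bddBelow_Iio a (hK.bddBelow.mono hs)

lemma mem_closure_image_Ioi (hφ : IsOpenEmbedding φ) (hr : range φ = {p}ᶜ) (a : ℝ) :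
    p ∈ closure (φ '' Ioi a) :=
  mem_closure_image hφ hr fun _ hK hs => not_bddAbove_Ioi a (hK.bddAbove.mono hs)

lemma isConnected_compl_image_Icc (hφ : IsOpenEmbedding φ) (hr : range φ = {p}ᶜ) (a b : ℝ) :
    IsConnected (φ '' Icc a b)ᶜ := by
  have hpr : p ∉ range φ := by simp [hr]
  have hL : IsPreconnected (insert p (φ '' Iio a)) :=
    (isPreconnected_Iio.image _ hφ.continuous.continuousOn).subset_closure (subset_insert _ _)
      (insert_subset (mem_closure_image_Iio hφ hr a) subset_closure)
  have hR : IsPreconnected (insert p (φ '' Ioi b)) :=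
    (isPreconnected_Ioi.image _ hφ.continuous.continuousOn).subset_closure (subset_insert _ _)
      (insert_subset (mem_closure_image_Ioi hφ hr b) subset_closure)
  have heq : (φ '' Icc a b)ᶜ = insert p (φ '' Iio a) ∪ insert p (φ '' Ioi b) := by
    ext z
    by_cases hz : z = p
    · subst hz
      simpa using fun x _ _ hx => hpr ⟨x, hx⟩
    · obtain ⟨t, rfl⟩ : z ∈ range φ := by simpa [hr] using hz
      simp only [mem_compl_iff, mem_union, mem_insert_iff, hz, false_or,
        hφ.injective.mem_set_image, mem_Icc, mem_Iio, mem_Ioi]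
      rw [not_and_or, not_le, not_le]
  rw [heq]
  exact ⟨⟨p, Or.inl (mem_insert _ _)⟩,
    hL.union p (mem_insert _ _) (mem_insert _ _) hR⟩

lemma frontier_compl_image_Icc_subset (hφ : IsOpenEmbedding φ) {a b : ℝ} (hab : a < b) :
    frontier (φ '' Icc a b)ᶜ ⊆ {φ a, φ b} := by
  have hcl : IsClosed (φ '' Icc a b) := (isCompact_Icc.image hφ.continuous).isClosed
  rw [frontier_compl, hcl.frontier_eq]
  rintro _ ⟨⟨t, ht, rfl⟩, hni⟩
  by_contra hne
  simp only [mem_insert_iff, mem_singleton_iff, not_or] at hne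
  refine hni (interior_maximal (image_mono Ioo_subset_Icc_self)
    (hφ.isOpenMap _ isOpen_Ioo) ⟨t, ⟨ht.1.lt_of_ne ?_, ht.2.lt_of_ne ?_⟩, rfl⟩)
  · rintro rfl; exact hne.1 rfl
  · rintro rfl; exact hne.2 rfl

lemma closure_image_Ioo_subset (hφ : IsOpenEmbedding φ) (a b : ℝ) :
    closure (φ '' Ioo a b) ⊆ φ '' Icc a b :=
  closure_minimal (image_mono Ioo_subset_Icc_self)
    (isCompact_Icc.image hφ.continuous).isClosed

lemma frontier_image_Ioo_subset (hφ : IsOpenEmbedding φ) (a b : ℝ) :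
    frontier (φ '' Ioo a b) ⊆ {φ a, φ b} := by
  rw [(hφ.isOpenMap _ isOpen_Ioo).frontier_eq]
  rintro z ⟨hz, hni⟩
  obtain ⟨t, ht, rfl⟩ := closure_image_Ioo_subset hφ a b hz
  by_contra hne
  simp only [mem_insert_iff, mem_singleton_iff, not_or] at hne
  refine hni ⟨t, ⟨ht.1.lt_of_ne ?_, ht.2.lt_of_ne ?_⟩, rfl⟩
  · rintro rfl; exact hne.1 rfl
  · rintro rfl; exact hne.2 rfl

end Line

/-- If `V n` has points on both sides of a point `t` outside its closure, there is a gap with both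
endpoints in the frontier of `V n`. -/
lemma exists_gap (hV : IsAdmissible V) {n : ℕ} {t : ℝ} (ht : t ∉ closure (V n))
    (hlow : ∃ s ∈ V n, s < t) (hhigh : ∃ s ∈ V n, t < s) :
    ∃ a b, IsGap V a b ∧ a ∈ frontier (V n) ∧ b ∈ frontier (V n) := by
  obtain ⟨s, hs, hst⟩ := hlow
  obtain ⟨s', hs', hst'⟩ := hhigh
  have ha : sSup (closure (V n) ∩ Iic t) ∈ closure (V n) ∩ Iic t :=
    (isClosed_closure.inter isClosed_Iic).csSup_mem ⟨s, subset_closure hs, hst.le⟩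
      (bddAbove_Iic.mono inter_subset_right)
  have hb : sInf (closure (V n) ∩ Ici t) ∈ closure (V n) ∩ Ici t :=
    (isClosed_closure.inter isClosed_Ici).csInf_mem ⟨s', subset_closure hs', hst'.le⟩
      (bddBelow_Ici.mono inter_subset_right)
  have hamax : ∀ z ∈ closure (V n), z ≤ t → z ≤ sSup (closure (V n) ∩ Iic t) := fun z hz hzt =>
    le_csSup (bddAbove_Iic.mono inter_subset_right) ⟨hz, hzt⟩
  have hbmin : ∀ z ∈ closure (V n), t ≤ z → sInf (closure (V n) ∩ Ici t) ≤ z := fun z hz hzt =>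
    csInf_le (bddBelow_Ici.mono inter_subset_right) ⟨hz, hzt⟩
  generalize sSup (closure (V n) ∩ Iic t) = a at *
  generalize sInf (closure (V n) ∩ Ici t) = b at *
  have hat : a < t := lt_of_le_of_ne ha.2 fun h => ht (h ▸ ha.1)
  have htb : t < b := lt_of_le_of_ne hb.2 fun h => ht (h ▸ hb.1)
  have hempty : V n ∩ Ioo a b = ∅ := by
    rw [eq_empty_iff_forall_notMem]
    rintro z ⟨hz, hza, hzb⟩
    rcases le_total z t with h | h
    · exact hza.not_ge (hamax z (subset_closure hz) h)
    · exact hzb.not_ge (hbmin z (subset_closure hz) h)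
  have haf : a ∈ frontier (V n) := by
    rw [(hV.isOpen _).frontier_eq]
    refine ⟨ha.1, fun h => ?_⟩
    obtain ⟨u, hu, hsub⟩ := exists_Ico_subset_of_mem_nhds ((hV.isOpen n).mem_nhds h) (exists_gt _)
    obtain ⟨z, hz⟩ := exists_between (lt_min hu hat)
    exact hz.1.not_ge (hamax z (subset_closure (hsub ⟨hz.1.le, hz.2.trans_le (min_le_left _ _)⟩))
      (hz.2.trans_le (min_le_right _ _)).le)
  have hbf : b ∈ frontier (V n) := by
    rw [(hV.isOpen _).frontier_eq]
    refine ⟨hb.1, fun h => ?_⟩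
    obtain ⟨l, hl, hsub⟩ := exists_Ioc_subset_of_mem_nhds ((hV.isOpen n).mem_nhds h) (exists_lt _)
    obtain ⟨z, hz⟩ := exists_between (max_lt hl htb)
    exact hz.2.not_ge (hbmin z (subset_closure (hsub ⟨(le_max_left _ _).trans_lt hz.1, hz.2.le⟩))
      ((le_max_right _ _).trans_lt hz.1).le)
  exact ⟨a, b, ⟨hat.trans htb, notMem_closure_inter hV haf hempty,
    notMem_closure_inter hV hbf hempty⟩, haf, hbf⟩

end Bridge

/-- The bridge construction: given open subsets `U n` of the unit circle with pairwise
disjoint closures, diameters tending to `0`, dense union, and no single `U n` dense,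
there is a sequence of nonempty connected open sets `I k` (bridges) with proper closures,
pairwise disjoint closures, each frontier contained in the frontier of some `U n`,
dense union, and whose complement is a Cantor set disjoint from `⋃ n, U n`. -/
theorem bridge_construction (U : ℕ → Set UnitCircle)
    (hopen : ∀ n, IsOpen (U n))
    (hdisj : ∀ m n, m ≠ n → Disjoint (closure (U m)) (closure (U n)))
    (hdiam : Filter.Tendsto (fun n => Metric.diam (U n)) Filter.atTop (nhds 0))
    (hdense : Dense (⋃ n, U n))
    (hnotdense : ∀ n, ¬ Dense (U n)) :
    ∃ I : ℕ → Set UnitCircle,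
      (∀ k, (I k).Nonempty) ∧
      (∀ k, IsConnected (I k)) ∧
      (∀ k, IsOpen (I k)) ∧
      (∀ k, closure (I k) ≠ Set.univ) ∧
      (∀ j k, j ≠ k → Disjoint (closure (I j)) (closure (I k))) ∧
      (∀ k, ∃ n, frontier (I k) ⊆ frontier (U n)) ∧
      Dense (⋃ k, I k) ∧
      IsCantorSet ((⋃ k, I k)ᶜ) ∧
      Disjoint ((⋃ k, I k)ᶜ) (⋃ n, U n) := by
  obtain ⟨p, hp⟩ := hdense.nonempty (h := ⟨⟨1, by simp⟩⟩)
  obtain ⟨n₀, hpn⟩ := mem_iUnion.1 hp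
  obtain ⟨φ, hφ, hr⟩ := Bridge.exists_isOpenEmbedding_range_eq_compl p
  set V : ℕ → Set ℝ := fun n => φ ⁻¹' U n with hVdef
  have hclos : ∀ n, closure (V n) = φ ⁻¹' closure (U n) := fun n =>
    (hφ.isOpenMap.preimage_closure_eq_closure_preimage hφ.continuous _).symm
  have hfront : ∀ n t, t ∈ frontier (V n) → φ t ∈ frontier (U n) := fun n t ht => by
    rwa [← hφ.isOpenMap.preimage_frontier_eq_frontier_preimage hφ.continuous] at ht
  have hV : Bridge.IsAdmissible V := by
    refine ⟨fun n => (hopen n).preimage hφ.continuous, fun m n hmn => ?_, ?_⟩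
    · rw [hclos, hclos]
      exact (hdisj m n hmn).preimage φ
    · rw [← preimage_iUnion]
      exact hdense.preimage hφ.isOpenMap
  obtain ⟨a, b, hgap, haf, hbf⟩ :
      ∃ a b, Bridge.IsGap V a b ∧ a ∈ frontier (V n₀) ∧ b ∈ frontier (V n₀) := by
    obtain ⟨q, hq⟩ : ∃ q, q ∉ closure (U n₀) := by
      by_contra! h
      exact hnotdense n₀ h
    obtain ⟨t, rfl⟩ : q ∈ range φ := by
      rw [hr]
      rintro rfl
      exact hq (subset_closure hpn)
    refine Bridge.exists_gap (n := n₀) (t := t) hV (by rwa [hclos]) ?_ ?_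
    · obtain ⟨_, hs, s, hst, rfl⟩ :=
        mem_closure_iff.1 (Bridge.mem_closure_image_Iio hφ hr t) _ (hopen n₀) hpn
      exact ⟨s, hs, hst⟩
    · obtain ⟨_, hs, s, hst, rfl⟩ :=
        mem_closure_iff.1 (Bridge.mem_closure_image_Ioi hφ hr t) _ (hopen n₀) hpn
      exact ⟨s, hs, hst⟩
  have hab := hgap.lt
  set c : List Bool → ℝ := fun w => (Bridge.bridge V w a b).1
  set d : List Bool → ℝ := fun w => (Bridge.bridge V w a b).2
  have hac : ∀ w, a < c w := fun w => (Bridge.bridge_spec hV w hgap).1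
  have hcd : ∀ w, c w < d w := fun w => (Bridge.bridge_spec hV w hgap).2.1
  have hdb : ∀ w, d w < b := fun w => (Bridge.bridge_spec hV w hgap).2.2.1
  have htype : ∀ w, ∃ n, c w ∈ frontier (V n) ∧ d w ∈ frontier (V n) :=
    fun w => (Bridge.bridge_spec hV w hgap).2.2.2
  have hIcc : ∀ v w, v ≠ w → Disjoint (Icc (c v) (d v)) (Icc (c w) (d w)) :=
    fun v w hvw => Bridge.bridge_disjoint hV v w hvw hgap
  have hcover : ∀ n, ∀ t ∈ V n, t ∈ Icc a b → t ∈ ⋃ w, Ioo (c w) (d w) := by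
    intro n t ht htab
    rw [(hV.isOpen _).frontier_eq] at haf hbf
    refine mem_iUnion.2 (Bridge.exists_mem_bridge hV ht hgap
      ⟨htab.1.lt_of_ne ?_, htab.2.lt_of_ne ?_⟩)
    · rintro rfl; exact hV.notMem haf.1 haf.2 ht
    · rintro rfl; exact hV.notMem hbf.1 hbf.2 ht
  let J : Option (List Bool) → Set UnitCircle := fun o =>
    o.elim (φ '' Icc a b)ᶜ fun w => φ '' Ioo (c w) (d w)
  have hJopen : ∀ o, IsOpen (J o) := by
    rintro (_ | w)
    · exact (isCompact_Icc.image hφ.continuous).isClosed.isOpen_compl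
    · exact hφ.isOpenMap _ isOpen_Ioo
  have hJconn : ∀ o, IsConnected (J o) := by
    rintro (_ | w)
    · exact Bridge.isConnected_compl_image_Icc hφ hr a b
    · exact (isConnected_Ioo (hcd w)).image _ hφ.continuous.continuousOn
  have hJfront : ∀ o, ∃ n, frontier (J o) ⊆ frontier (U n) := by
    rintro (_ | w)
    · refine ⟨n₀, (Bridge.frontier_compl_image_Icc_subset hφ hab).trans ?_⟩
      rintro _ (rfl | rfl)
      exacts [hfront _ _ haf, hfront _ _ hbf]
    · obtain ⟨n, hc, hd⟩ := htype w
      refine ⟨n, (Bridge.frontier_image_Ioo_subset hφ _ _).trans ?_⟩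
      rintro _ (rfl | rfl)
      exacts [hfront _ _ hc, hfront _ _ hd]
  have hnone : closure (J none) ⊆ (φ '' Ioo a b)ᶜ :=
    closure_minimal (compl_subset_compl.2 (image_mono Ioo_subset_Icc_self))
      (hφ.isOpenMap _ isOpen_Ioo).isClosed_compl
  have hsome : ∀ w, closure (J (some w)) ⊆ φ '' Icc (c w) (d w) := fun w =>
    Bridge.closure_image_Ioo_subset hφ _ _
  have hns : ∀ w, Disjoint (closure (J none)) (closure (J (some w))) := fun w =>
    (disjoint_compl_left_iff_subset.2 (image_mono (Icc_subset_Ioo (hac w) (hdb w)))).mono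
      hnone (hsome w)
  have hJdisj : ∀ o o', o ≠ o' → Disjoint (closure (J o)) (closure (J o')) := by
    rintro (_ | v) (_ | w) hne
    · exact absurd rfl hne
    · exact hns w
    · exact (hns v).symm
    · exact ((disjoint_image_iff hφ.injective).2 (hIcc v w (by simpa using hne))).mono
        (hsome v) (hsome w)
  have hJproper : ∀ o, closure (J o) ≠ univ := by
    intro o h
    obtain ⟨o', hne⟩ := exists_ne o
    obtain ⟨z, hz⟩ := (hJconn o').nonempty
    exact (hJdisj o o' hne.symm).le_bot ⟨h ▸ mem_univ z, subset_closure hz⟩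
  have hUJ : ⋃ n, U n ⊆ ⋃ o, J o := by
    refine iUnion_subset fun n z hz => ?_
    by_cases hzI : z ∈ φ '' Icc a b
    · obtain ⟨t, ht, rfl⟩ := hzI
      obtain ⟨w, hw⟩ := mem_iUnion.1 (hcover n t hz ht)
      exact mem_iUnion.2 ⟨some w, t, hw, rfl⟩
    · exact mem_iUnion.2 ⟨none, hzI⟩
  have hK : (⋃ o, J o)ᶜ = φ '' (Icc a b \ ⋃ w, Ioo (c w) (d w)) := by
    rw [iUnion_option, compl_union, image_sdiff hφ.injective, image_iUnion, sdiff_eq]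
    simp [J]
  have hcomp : IsCompact (⋃ o, J o)ᶜ := (isOpen_iUnion hJopen).isClosed_compl.isCompact
  have hCantor : IsCantorSet (⋃ o, J o)ᶜ := by
    refine ⟨?_, hcomp, ⟨hcomp.isClosed, ?_⟩, ?_⟩
    · rw [hK]
      refine ⟨φ a, a, ⟨left_mem_Icc.2 hab.le, ?_⟩, rfl⟩
      simp only [mem_iUnion, not_exists]
      exact fun w hw => (hac w).not_gt hw.1
    · rw [hK]
      exact (Bridge.preperfect_Icc_diff hab hac hcd hdb hIcc).image hφ.continuous hφ.injective
    · rw [hK, hφ.isEmbedding.isTotallyDisconnected_image]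
      refine Bridge.isTotallyDisconnected_of_dense_compl (hV.dense.mono ?_)
      refine iUnion_subset fun n t ht htK => ?_
      exact htK.2 (hcover n t ht htK.1)
  obtain ⟨_⟩ := nonempty_denumerable (Option (List Bool))
  let e : ℕ ≃ Option (List Bool) := (Denumerable.eqv _).symm
  have hunion : ⋃ k, J (e k) = ⋃ o, J o := e.surjective.iUnion_comp J
  refine ⟨fun k => J (e k), fun k => (hJconn _).nonempty, fun k => hJconn _, fun k => hJopen _,
    fun k => hJproper _, fun j k hjk => hJdisj _ _ (e.injective.ne hjk), fun k => hJfront _, ?_⟩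
  rw [hunion]
  exact ⟨hdense.mono hUJ, hCantor, disjoint_compl_left_iff_subset.2 hUJ⟩
end

section
/- Let C = {z ∈ ℂ : |z| = 1} be the unit circle, and let (I_k)_{k∈ℕ} be a sequence of connected open subsets of C such that the closures of the I_k are pairwise disjoint, the closure of each I_k is a proper subset of C, and ⋃_k I_k is dense in C. Then K = C \ ⋃_k I_k is a Cantor set: it is nonempty, compact, perfect and totally disconnected. In particular, K is uncountable. -/
open Set in
/-- The circle punctured at `x` is parametrized by the open interval `(-π, π)`, and the
parametrization extends continuously to the line, sending both endpoints to `x`. -/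
theorem UnitCircle.exists_angular_chart (x : UnitCircle) :
    ∃ (f : ℝ → UnitCircle) (g : UnitCircle → ℝ), Continuous f ∧ ContinuousOn g {x}ᶜ ∧
      f (-Real.pi) = x ∧ f Real.pi = x ∧ (∀ z, f (g z) = z) ∧
      (∀ z, z ≠ x → g z ∈ Ioo (-Real.pi) Real.pi) ∧
      ∀ t ∈ Ioo (-Real.pi) Real.pi, g (f t) = t ∧ f t ≠ x := by
  have hnorm (z : UnitCircle) : ‖(z : ℂ)‖ = 1 := by simp
  have hx0 : (x : ℂ) ≠ 0 := by
    rw [← norm_ne_zero_iff, hnorm]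
    exact one_ne_zero
  let f : ℝ → UnitCircle := fun t => ⟨-x * Complex.exp (t * Complex.I), by
    simp [Complex.norm_exp_ofReal_mul_I, hnorm]⟩
  let g : UnitCircle → ℝ := fun z => Complex.arg (-z / x)
  have hf_coe (t : ℝ) : (f t : ℂ) = -x * Complex.exp (t * Complex.I) := rfl
  have hfg (z : UnitCircle) : f (g z) = z := by
    apply Subtype.ext
    have h := Complex.norm_mul_exp_arg_mul_I (-(z : ℂ) / x)
    rw [norm_div, norm_neg, hnorm, hnorm, div_one, Complex.ofReal_one, one_mul] at h
    rw [hf_coe, h]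
    field_simp
  have hf_pi : f Real.pi = x := by
    apply Subtype.ext
    rw [hf_coe, Complex.exp_pi_mul_I]
    ring
  have hg_ne (z : UnitCircle) (hz : z ≠ x) : g z ≠ Real.pi := by
    intro h
    apply hz
    rw [← hfg z, h, hf_pi]
  have hgf (t : ℝ) (ht : t ∈ Ioo (-Real.pi) Real.pi) : g (f t) = t := by
    have h : -(f t : ℂ) / x = Complex.exp (t * Complex.I) := by
      rw [hf_coe]
      field_simp
    simp only [g, h]
    rw [Complex.arg_exp_mul_I, toIocMod_eq_self]
    constructor <;> linarith [ht.1, ht.2]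
  have hg_x : g x = Real.pi := by
    simp only [g]
    rw [neg_div, div_self hx0, Complex.arg_neg_one]
  refine ⟨f, g, ?_, ?_, ?_, hf_pi, hfg, ?_, ?_⟩
  · exact Continuous.subtype_mk (by fun_prop) _
  · intro z hz
    apply ContinuousAt.continuousWithinAt
    have hslit : -(z : ℂ) / x ∈ Complex.slitPlane := by
      rw [Complex.mem_slitPlane_iff_arg]
      refine ⟨hg_ne z hz, ?_⟩
      rw [← norm_ne_zero_iff, norm_div, norm_neg, hnorm, hnorm]
      norm_num
    exact (Complex.continuousAt_arg hslit).comp (f := fun z : UnitCircle => -(z : ℂ) / x)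
      (by fun_prop)
  · apply Subtype.ext
    rw [hf_coe, Complex.ofReal_neg, neg_mul (Real.pi : ℂ), Complex.exp_neg_pi_mul_I]
    ring
  · intro z hz
    exact ⟨Complex.neg_pi_lt_arg _, lt_of_le_of_ne (Complex.arg_le_pi _) (hg_ne z hz)⟩
  · intro t ht
    refine ⟨hgf t ht, fun h => ?_⟩
    have := hgf t ht
    rw [h, hg_x] at this
    exact ht.2.ne' this

instance : PreconnectedSpace UnitCircle := by
  obtain ⟨f, g, hf, -, -, -, hfg, -⟩ := UnitCircle.exists_angular_chart ⟨1, by simp⟩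
  exact (Function.RightInverse.surjective hfg).denseRange.preconnectedSpace hf

open Set in
theorem IsPreconnected.exists_subset_of_subset_iUnion_of_pairwise_disjoint
    {X ι : Type*} [TopologicalSpace X] {I : ι → Set X} {s : Set X} (hs : IsPreconnected s)
    (hne : s.Nonempty) (hopen : ∀ k, IsOpen (I k))
    (hdisj : Pairwise fun j k => Disjoint (I j) (I k)) (hsub : s ⊆ ⋃ k, I k) :
    ∃ k, s ⊆ I k := by
  obtain ⟨a, ha⟩ := hne
  obtain ⟨k, hk⟩ := mem_iUnion.1 (hsub ha)
  refine ⟨k, hs.subset_left_of_subset_union (v := ⋃ j, ⋃ _ : j ≠ k, I j) (hopen k)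
    (isOpen_iUnion fun j => isOpen_iUnion fun _ => hopen j) ?_ ?_ ⟨a, ha, hk⟩⟩
  · simp only [disjoint_iUnion_right]
    exact fun j hj => hdisj hj.symm
  · intro z hz
    obtain ⟨j, hj⟩ := mem_iUnion.1 (hsub hz)
    by_cases h : j = k
    · exact Or.inl (h ▸ hj)
    · exact Or.inr (mem_iUnion₂.2 ⟨j, h, hj⟩)

open Set in
theorem UnitCircle.isTotallyDisconnected_compl_of_dense {U : Set UnitCircle} (hU : Dense U) :
    IsTotallyDisconnected Uᶜ := by
  intro S hSU hS
  have : Nonempty UnitCircle := ⟨⟨1, by simp⟩⟩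
  obtain ⟨p, hp⟩ := hU.nonempty
  obtain ⟨f, g, -, hg, -, -, hfg, hg_mem, hgf⟩ := UnitCircle.exists_angular_chart p
  have hne : ∀ z ∈ S, z ≠ p := fun z hz h => hSU hz (h ▸ hp)
  have hgS : OrdConnected (g '' S) := (hS.image g (hg.mono hne)).ordConnected
  have key : ∀ a ∈ S, ∀ b ∈ S, ¬ g a < g b := by
    intro a ha b hb hab
    obtain ⟨t, ht⟩ := exists_between hab
    have htI : t ∈ Ioo (-Real.pi) Real.pi :=
      ⟨(hg_mem a (hne a ha)).1.trans ht.1, ht.2.trans (hg_mem b (hne b hb)).2⟩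
    obtain ⟨z, hz, hzU⟩ := hU.inter_open_nonempty ({p}ᶜ ∩ g ⁻¹' Ioo (g a) (g b))
      (hg.isOpen_inter_preimage isOpen_compl_singleton isOpen_Ioo)
      ⟨f t, (hgf t htI).2, by rw [mem_preimage, (hgf t htI).1]; exact ht⟩
    obtain ⟨w, hw, hwz⟩ := hgS.out (mem_image_of_mem g ha) (mem_image_of_mem g hb)
      (Ioo_subset_Icc_self hz.2)
    have hwz' : w = z := by rw [← hfg w, hwz, hfg]
    exact hSU hw (hwz' ▸ hzU)
  intro a ha b hb
  rw [← hfg a, ← hfg b, le_antisymm (not_lt.1 (key b hb a ha)) (not_lt.1 (key a ha b hb))]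

open Set Filter Topology in
theorem UnitCircle.preperfect_compl_iUnion {ι : Type*} {I : ι → Set UnitCircle}
    (hconn : ∀ k, IsPreconnected (I k)) (hopen : ∀ k, IsOpen (I k))
    (hdisj : ∀ j k, j ≠ k → Disjoint (closure (I j)) (closure (I k)))
    (hproper : ∀ k, closure (I k) ≠ univ) : Preperfect (⋃ k, I k)ᶜ := by
  intro x hx
  by_contra hacc
  rw [accPt_iff_nhds] at hacc
  push Not at hacc
  obtain ⟨V, hV, hVx⟩ := hacc
  obtain ⟨f, g, hf, hg, hf_neg, hf_pos, hfg, hg_mem, hgf⟩ :=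
    UnitCircle.exists_angular_chart x
  have hpi := Real.pi_pos
  have side : ∀ s ⊆ Ioo (-Real.pi) Real.pi, s.Nonempty → IsPreconnected s →
      s ⊆ f ⁻¹' V → ∃ k, f '' s ⊆ I k := by
    intro s hs hne hsc hsV
    refine (hsc.image f hf.continuousOn).exists_subset_of_subset_iUnion_of_pairwise_disjoint
      (hne.image f) hopen
      (fun j k hjk => (hdisj j k hjk).mono subset_closure subset_closure) ?_
    rintro _ ⟨t, ht, rfl⟩
    by_contra h
    exact (hgf t (hs ht)).2 (hVx _ ⟨hsV ht, h⟩)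
  have hVneg : f ⁻¹' V ∈ 𝓝 (-Real.pi) := hf.continuousAt.preimage_mem_nhds (hf_neg ▸ hV)
  have hVpos : f ⁻¹' V ∈ 𝓝 Real.pi := hf.continuousAt.preimage_mem_nhds (hf_pos ▸ hV)
  obtain ⟨a, ha, haV⟩ := (mem_nhdsGT_iff_exists_mem_Ioc_Ioo_subset
    (show -Real.pi < Real.pi by linarith)).1 (mem_nhdsWithin_of_mem_nhds hVneg)
  obtain ⟨b, hb, hbV⟩ := (mem_nhdsLT_iff_exists_mem_Ico_Ioo_subset
    (show -Real.pi < Real.pi by linarith)).1 (mem_nhdsWithin_of_mem_nhds hVpos)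
  obtain ⟨j, hj⟩ := side (Ioo (-Real.pi) a) (Ioo_subset_Ioo_right ha.2)
    (nonempty_Ioo.2 ha.1) isPreconnected_Ioo haV
  obtain ⟨k, hk⟩ := side (Ioo b Real.pi) (Ioo_subset_Ioo_left hb.1)
    (nonempty_Ioo.2 hb.2) isPreconnected_Ioo hbV
  have hxj : x ∈ closure (I j) := by
    rw [← hf_neg]
    refine closure_mono hj (image_closure_subset_closure_image hf (mem_image_of_mem f ?_))
    rw [closure_Ioo ha.1.ne]
    exact left_mem_Icc.2 ha.1.le
  have hxk : x ∈ closure (I k) := by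
    rw [← hf_pos]
    refine closure_mono hk (image_closure_subset_closure_image hf (mem_image_of_mem f ?_))
    rw [closure_Ioo hb.2.ne]
    exact right_mem_Icc.2 hb.2.le
  obtain rfl : j = k := by
    by_contra h
    exact disjoint_left.1 (hdisj j k h) hxj hxk
  have hne : ∀ z ∈ I j, z ≠ x := fun z hz h => hx (mem_iUnion.2 ⟨j, h ▸ hz⟩)
  have hgI : OrdConnected (g '' I j) := ((hconn j).image g (hg.mono hne)).ordConnected
  apply hproper j
  rw [eq_univ_iff_forall]
  intro z
  by_cases hz : z = x
  · exact hz ▸ hxj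
  apply subset_closure
  obtain ⟨hz1, hz2⟩ := hg_mem z hz
  obtain ⟨s, hs1, hs2⟩ := exists_between (lt_min ha.1 hz1)
  obtain ⟨t, ht1, ht2⟩ := exists_between (max_lt hb.2 hz2)
  rw [lt_min_iff] at hs2
  rw [max_lt_iff] at ht1
  have hs : s ∈ g '' I j :=
    ⟨f s, hj (mem_image_of_mem f ⟨hs1, hs2.1⟩), (hgf s ⟨hs1, hs2.2.trans hz2⟩).1⟩
  have ht : t ∈ g '' I j :=
    ⟨f t, hk (mem_image_of_mem f ⟨ht1.1, ht2⟩), (hgf t ⟨hz1.trans ht1.2, ht2⟩).1⟩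
  obtain ⟨w, hw, hwz⟩ := hgI.out hs ht ⟨hs2.2.le, ht1.2.le⟩
  rwa [← hfg z, ← hwz, hfg]

theorem Perfect.not_countable {X : Type*} [MetricSpace X] [CompleteSpace X] {K : Set X}
    (hK : Perfect K) (hne : K.Nonempty) : ¬ K.Countable := by
  intro hc
  obtain ⟨f, hfK, -, hf⟩ := hK.exists_nat_bool_injection hne
  have : Uncountable (ℕ → Bool) := by
    rw [← Cardinal.aleph0_lt_mk_iff]
    simpa using Cardinal.cantor Cardinal.aleph0
  exact Set.not_countable_univ
    (Set.MapsTo.countable_of_injOn (fun z _ => hfK (Set.mem_range_self z)) hf.injOn hc)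

/-- If `(I k)` is a sequence of connected open subsets of the unit circle with pairwise
disjoint closures, each closure a proper subset of the circle, and dense union, then the
complement `K = C \ ⋃ k, I k` is a Cantor set; in particular it is uncountable. -/
theorem complement_of_arcs_is_cantor (I : ℕ → Set UnitCircle)
    (hconn : ∀ k, IsConnected (I k))
    (hopen : ∀ k, IsOpen (I k))
    (hdisj : ∀ j k, j ≠ k → Disjoint (closure (I j)) (closure (I k)))
    (hproper : ∀ k, closure (I k) ≠ Set.univ)
    (hdense : Dense (⋃ k, I k)) :
    IsCantorSet ((⋃ k, I k)ᶜ) ∧ ¬ ((⋃ k, I k)ᶜ : Set UnitCircle).Countable := by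
  have hperfect : Perfect (⋃ k, I k)ᶜ :=
    ⟨(isOpen_iUnion hopen).isClosed_compl,
      UnitCircle.preperfect_compl_iUnion (fun k => (hconn k).isPreconnected) hopen hdisj hproper⟩
  have hne : (⋃ k, I k)ᶜ.Nonempty := by
    rw [Set.nonempty_compl]
    intro hcover
    obtain ⟨z, -⟩ := (hconn 0).nonempty
    obtain ⟨k, hk⟩ :=
      isPreconnected_univ.exists_subset_of_subset_iUnion_of_pairwise_disjoint ⟨z, trivial⟩ hopen
        (fun j k hjk => (hdisj j k hjk).mono subset_closure subset_closure) hcover.ge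
    exact hproper k (Set.univ_subset_iff.1 (hk.trans subset_closure))
  exact ⟨⟨hne, hperfect.closed.isCompact, hperfect,
    UnitCircle.isTotallyDisconnected_compl_of_dense hdense⟩, hperfect.not_countable hne⟩
end

section
/- Let D be a Jordan disk in S² and let C = S² ∩ P be a circle on S², where P ⊆ ℝ³ is an affine plane. If C is contained in the closure of D, then at least one of the two open spherical caps bounded by C is contained in the closure of D. -/
open scoped RealInnerProductSpace

/-- A continuous logarithm along a circle winding once around the origin is not periodic. -/
theorem log_circle_ne {r : ℝ} {w : ℂ} (hw : ‖w‖ < r) {l : ℝ → ℂ} (hl : Continuous l)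
    (hexp : ∀ t : ℝ, Complex.exp (l t) = r * Complex.exp (t * Complex.I) - w) :
    l 0 ≠ l (2 * Real.pi) := by
  intro hper
  have hslit (t : ℝ) : (r : ℂ) - w * Complex.exp (-(t * Complex.I)) ∈ Complex.slitPlane := by
    refine Complex.mem_slitPlane_iff.2 (Or.inl ?_)
    have h1 := Complex.re_le_norm (w * Complex.exp (-(t * Complex.I)))
    have h2 : ‖Complex.exp (-(t * Complex.I))‖ = 1 := by
      simpa using Complex.norm_exp_ofReal_mul_I (-t)
    rw [norm_mul, h2, mul_one] at h1
    simp only [Complex.sub_re, Complex.ofReal_re]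
    linarith
  set M : ℝ → ℂ := fun t ↦ l t - Complex.log (r - w * Complex.exp (-(t * Complex.I))) with hM
  have hMc : Continuous M :=
    hl.sub (Continuous.clog (by fun_prop) hslit)
  have hMexp (t : ℝ) : Complex.exp (M t) = Complex.exp (t * Complex.I) := by
    have h0 := Complex.slitPlane_ne_zero (hslit t)
    rw [hM, Complex.exp_sub, Complex.exp_log h0, hexp, div_eq_iff h0, mul_sub]
    have : Complex.exp (t * Complex.I) * Complex.exp (-(t * Complex.I)) = 1 := by
      rw [← Complex.exp_add]; simp
    linear_combination w * this
  have hMlin : M = fun t : ℝ ↦ M 0 + t * Complex.I := by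
    refine Complex.isCoveringMap_exp.eq_of_comp_eq hMc (by fun_prop) ?_ 0 (by simp)
    funext t
    refine Subtype.ext ?_
    have h0 : Complex.exp (M 0) = 1 := by simpa using hMexp 0
    simp [hMexp t, Complex.exp_add, h0]
  have h2 := congrFun hMlin (2 * Real.pi)
  have he : Complex.exp (-(((2 * Real.pi : ℝ) : ℂ) * Complex.I)) = 1 := by
    rw [Complex.exp_neg]; simp [Complex.exp_two_pi_mul_I]
  have h3 : M (2 * Real.pi) = M 0 := by
    simp only [hM, he, ← hper]; simp
  rw [h3] at h2
  simp [Real.pi_ne_zero] at h2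

/-- A nonvanishing continuous function on an embedded closed disk has a continuous logarithm
along every path in the disk, with equal values at parameters giving the same point. -/
theorem exists_log_along_of_disk {E : Type*} [TopologicalSpace E] [T2Space E] {f : ℂ → E}
    (hf : ContinuousOn f (Metric.closedBall 0 1)) (hinj : Set.InjOn f (Metric.closedBall 0 1))
    {g : E → ℂ} (hg : Continuous g) (hg0 : ∀ x ∈ f '' Metric.closedBall 0 1, g x ≠ 0)
    {γ : ℝ → E} (hγ : Continuous γ) (hmem : ∀ t, γ t ∈ f '' Metric.closedBall 0 1) :
    ∃ l : ℝ → ℂ, Continuous l ∧ (∀ t, Complex.exp (l t) = g (γ t)) ∧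
      ∀ s t, γ s = γ t → l s = l t := by
  set ρ : ℂ → ℂ := fun z ↦ ((max 1 ‖z‖)⁻¹ : ℝ) • z with hρ
  have hpos (z : ℂ) : 0 < max 1 ‖z‖ := lt_max_of_lt_left one_pos
  have hρc : Continuous ρ := by
    refine Continuous.smul (Continuous.inv₀ (by fun_prop) fun z ↦ (hpos z).ne') continuous_id
  have hρm (z : ℂ) : ρ z ∈ Metric.closedBall (0 : ℂ) 1 := by
    rw [mem_closedBall_zero_iff, hρ, norm_smul, norm_inv, Real.norm_of_nonneg (hpos z).le,
      inv_mul_le_iff₀ (hpos z), mul_one]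
    exact le_max_right _ _
  have hρid (z : ℂ) (hz : z ∈ Metric.closedBall (0 : ℂ) 1) : ρ z = z := by
    rw [mem_closedBall_zero_iff] at hz
    simp [hρ, max_eq_left hz]
  obtain ⟨L, hLc, hL⟩ := Complex.exists_continuousOn_eqOn_exp_comp (X := ℂ) (U := Set.univ)
    (g := fun z ↦ g (f (ρ z)))
    ((Homeomorph.Set.univ ℂ).toHomotopyEquiv.simplyConnectedSpace_iff.2 inferInstance) isOpen_univ
    (hg.comp (hf.comp_continuous hρc hρm)).continuousOn
    (by rintro ⟨z, -, hz⟩; exact hg0 _ ⟨_, hρm z, rfl⟩ hz)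
  rw [continuousOn_univ] at hLc
  have hemb : Topology.IsClosedEmbedding (fun z : Metric.closedBall (0 : ℂ) 1 ↦ f z) :=
    Continuous.isClosedEmbedding (continuousOn_iff_continuous_domRestrict.1 hf)
      (fun a b h ↦ Subtype.ext (hinj a.2 b.2 h))
  choose δ hδm hδ using hmem
  have hδc : Continuous fun t ↦ (⟨δ t, hδm t⟩ : Metric.closedBall (0 : ℂ) 1) := by
    rw [hemb.isEmbedding.continuous_iff]
    exact hγ.congr fun t ↦ (hδ t).symm
  refine ⟨fun t ↦ L (δ t), hLc.comp (continuous_subtype_val.comp hδc), fun t ↦ ?_,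
    fun s t h ↦ ?_⟩
  · have := hL (Set.mem_univ (δ t))
    simpa [hρid _ (hδm t), hδ] using this
  · exact congrArg L (hinj (hδm s) (hδm t) (by rw [hδ, hδ, h]))

/-- Let `p` and `q` be points of the sphere on opposite sides of a plane `⟪v, x⟫ = c`. Then
there are a loop in the circle cut out by the plane and a function to `ℂ` vanishing on the sphere
only at `p` and `q`, which maps the loop to a circle winding once around the origin. -/
theorem exists_winding_map {p q v : EuclideanSpace ℝ (Fin 3)} {c : ℝ}
    (hp : p ∈ S2) (hq : q ∈ S2) (hpc : ⟪v, p⟫ < c) (hqc : c < ⟪v, q⟫) :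
    ∃ (g : EuclideanSpace ℝ (Fin 3) → ℂ) (γ : ℝ → EuclideanSpace ℝ (Fin 3)) (r : ℝ) (w : ℂ),
      Continuous g ∧ (∀ x ∈ S2, g x = 0 → x = p ∨ x = q) ∧ Continuous γ ∧
      (∀ t, γ t ∈ S2 ∩ {x | ⟪v, x⟫ = c}) ∧ γ 0 = γ (2 * Real.pi) ∧ ‖w‖ < r ∧
      ∀ t : ℝ, g (γ t) = r * Complex.exp (t * Complex.I) - w := by
  have hv : v ≠ 0 := by
    rintro rfl
    simp only [inner_zero_left] at hpc hqc
    exact hpc.not_gt hqc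
  have hpn : ‖p‖ = 1 := by simpa [S2] using hp
  have hqn : ‖q‖ = 1 := by simpa [S2] using hq
  have hvv : (0 : ℝ) < ⟪v, v⟫ := real_inner_self_pos.2 hv
  have hd : (0 : ℝ) < ⟪v, q - p⟫ := by rw [inner_sub_right]; linarith
  have hpp : ⟪p, p⟫ = 1 := by rw [real_inner_self_eq_norm_sq, hpn, one_pow]
  have hqq : ⟪q, q⟫ = 1 := by rw [real_inner_self_eq_norm_sq, hqn, one_pow]
  have hpq : ⟪p, q⟫ < 1 := by
    refine (inner_lt_one_iff_real_of_norm_eq_one hpn hqn).2 ?_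
    rintro rfl
    exact hpc.not_gt hqc
  let K := (Submodule.span ℝ {v})ᗮ
  have hfact : Fact (Module.finrank ℝ (EuclideanSpace ℝ (Fin 3)) = 2 + 1) := ⟨by simp⟩
  have hrank : Module.finrank ℝ K = 2 := Submodule.finrank_orthogonal_span_singleton hv
  let φ : K ≃ₗᵢ[ℝ] ℂ := ((stdOrthonormalBasis ℝ K).reindex (finCongr hrank)).equiv
    Complex.orthonormalBasisOneI (Equiv.refl _)
  let T : EuclideanSpace ℝ (Fin 3) → ℂ := fun x ↦ φ (K.orthogonalProjectionOnto x)
  have hTφ (z : ℂ) : T (φ.symm z) = z := by simp [T]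
  have hTsub (x y) : T (x - y) = T x - T y := by simp [T]
  have hTc : Continuous T := by fun_prop
  have hmemK (x : EuclideanSpace ℝ (Fin 3)) : x ∈ K ↔ ⟪v, x⟫ = 0 :=
    Submodule.mem_orthogonal_singleton_iff_inner_right
  have hTnorm (x : EuclideanSpace ℝ (Fin 3)) (hx : ⟪v, x⟫ = 0) : ‖T x‖ = ‖x‖ := by
    lift x to K using (hmemK x).2 hx
    simp [T]
  -- `π` projects onto the plane orthogonal to `v` along the line through `p` and `q`.
  let k : EuclideanSpace ℝ (Fin 3) → ℝ := fun x ↦ ⟪v, x - p⟫ / ⟪v, q - p⟫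
  let π : EuclideanSpace ℝ (Fin 3) → EuclideanSpace ℝ (Fin 3) := fun x ↦ x - p - k x • (q - p)
  have hπ (x) : ⟪v, π x⟫ = 0 := by
    simp only [π, k, inner_sub_right v (x - p), inner_smul_right]
    field_simp
    simp
  let s : ℝ := (c - ⟪v, p⟫) / ⟪v, q - p⟫
  have hs0 : 0 < s := div_pos (by linarith) hd
  have hs1 : s < 1 := by rw [div_lt_one hd, inner_sub_right]; linarith
  have hsd : s * ⟪v, q - p⟫ = c - ⟪v, p⟫ := div_mul_cancel₀ _ hd.ne'
  let m := p + s • (q - p)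
  let a := (c / ⟪v, v⟫) • v
  have hva : ⟪v, a⟫ = c := by simp only [a, inner_smul_right]; field_simp
  have hvm : ⟪v, m⟫ = c := by
    simp only [m, inner_add_right, inner_smul_right, hsd]; ring
  have hmm : ⟪m, m⟫ < 1 := by
    simp only [m, inner_add_right, inner_smul_right, inner_add_left, inner_smul_left,
      inner_sub_right, inner_sub_left, hpp, hqq, real_inner_comm p q]
    simp only [conj_trivial]
    nlinarith [mul_pos (mul_pos hs0 (sub_pos.2 hs1)) (sub_pos.2 hpq), real_inner_comm p q]
  have ham : ⟪a, m - a⟫ = 0 := by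
    simp only [a, inner_smul_left]
    rw [inner_sub_right, hvm, hva]; simp
  have hma : ‖m - a‖ ^ 2 = ⟪m, m⟫ - ⟪a, a⟫ := by
    have : m = a + (m - a) := by abel
    have h2 : ⟪m, m⟫ = ⟪a + (m - a), a + (m - a)⟫ := by rw [← this]
    rw [h2, inner_add_left, inner_add_right, inner_add_right, real_inner_comm a (m - a), ham,
      ← real_inner_self_eq_norm_sq]
    ring
  let r := Real.sqrt (1 - ⟪a, a⟫)
  have hr2 : r ^ 2 = 1 - ⟪a, a⟫ := Real.sq_sqrt (by nlinarith [sq_nonneg ‖m - a‖])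
  have hmar : ‖m - a‖ < r := lt_of_pow_lt_pow_left₀ 2 (Real.sqrt_nonneg _) (by linarith)
  let e : ℝ → ℂ := fun t ↦ r * Complex.exp (t * Complex.I)
  have he (t) : ‖e t‖ = r := by
    simp [e, Complex.norm_exp_ofReal_mul_I, r, abs_of_nonneg, Real.sqrt_nonneg]
  have hvφ (z : ℂ) : ⟪v, (φ.symm z : EuclideanSpace ℝ (Fin 3))⟫ = 0 := (hmemK _).1 (φ.symm z).2
  have hvγ (t : ℝ) : ⟪v, a + φ.symm (e t)⟫ = c := by
    rw [inner_add_right, hva, hvφ, add_zero]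
  refine ⟨fun x ↦ T (π x), fun t ↦ a + φ.symm (e t), r, T (m - a), by fun_prop, ?_, by fun_prop,
    fun t ↦ ⟨?_, hvγ t⟩, ?_, ?_, fun t ↦ ?_⟩
  · intro x hx h
    have hxn : ‖x‖ = 1 := by simpa [S2] using hx
    have h0 : π x = 0 := by rw [← norm_eq_zero, ← hTnorm _ (hπ x), norm_eq_zero]; exact h
    have hx' : x = p + k x • (q - p) := by
      rw [← sub_eq_zero, ← h0]; simp only [π]; abel
    generalize k x = u at hx'
    have hxx : ⟪x, x⟫ = 1 := by rw [real_inner_self_eq_norm_sq, hxn, one_pow]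
    rw [hx'] at hxx
    simp only [inner_add_right, inner_smul_right, inner_add_left, inner_smul_left,
      inner_sub_right, inner_sub_left, hpp, hqq, conj_trivial, real_inner_comm p q] at hxx
    have : u * (u - 1) * (1 - ⟪p, q⟫) = 0 := by
      have := real_inner_comm p q
      linarith
    rcases mul_eq_zero.1 this with h | h
    · rcases mul_eq_zero.1 h with h | h
      · left; rw [hx', h]; simp
      · right; rw [hx', sub_eq_zero.1 h]; simp
    · linarith
  · have h0 : ⟪a, (φ.symm (e t) : EuclideanSpace ℝ (Fin 3))⟫ = 0 := by
      simp only [a, inner_smul_left, hvφ, mul_zero]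
    have := norm_add_sq_eq_norm_sq_add_norm_sq_real h0
    have h1 : ‖(φ.symm (e t) : EuclideanSpace ℝ (Fin 3))‖ = r :=
      (K.norm_coe _).trans ((φ.symm.norm_map _).trans (he t))
    rw [h1, ← pow_two, ← pow_two, ← pow_two, hr2, ← real_inner_self_eq_norm_sq a] at this
    simp only [S2, mem_sphere_zero_iff_norm]
    refine (pow_eq_one_iff_of_nonneg (norm_nonneg _) two_ne_zero).1 ?_
    linarith
  · simp [e, Complex.exp_two_pi_mul_I]
  · rwa [hTnorm]
    rw [inner_sub_right, hvm, hva, sub_self]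
  · have hk : k (a + φ.symm (e t)) = s := by
      simp only [k, s]; rw [inner_sub_right, hvγ]
    have : π (a + φ.symm (e t)) = φ.symm (e t) - (m - a) := by
      simp only [π, hk, m]; abel
    change T (π (a + φ.symm (e t))) = _
    rw [this, hTsub, hTφ]

/-- If a circle `C = S² ∩ P` on the sphere is contained in the closure of a Jordan disk
`D`, then at least one of the two open spherical caps bounded by `C` is contained in the
closure of `D`. -/
theorem cap_in_closure_of_jordan_disk
    (D : Set (EuclideanSpace ℝ (Fin 3))) (hD : IsJordanDisk D)
    (v : EuclideanSpace ℝ (Fin 3)) (hv : v ≠ 0) (c : ℝ)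
    (hne : (S2 ∩ {x | ⟪v, x⟫ = c}).Nonempty)
    (hsub : S2 ∩ {x | ⟪v, x⟫ = c} ⊆ closure D) :
    S2 ∩ {x | ⟪v, x⟫ < c} ⊆ closure D ∨ S2 ∩ {x | c < ⟪v, x⟫} ⊆ closure D := by
  by_contra! h
  obtain ⟨p, ⟨hp, hpc⟩, hpD⟩ := Set.not_subset.1 h.1
  obtain ⟨q, ⟨hq, hqc⟩, hqD⟩ := Set.not_subset.1 h.2
  obtain ⟨hDS, -, f, hf, hinj, himg, -⟩ := hD
  obtain ⟨g, γ, r, w, hg, hg0, hγ, hγC, hper, hw, hgγ⟩ := exists_winding_map hp hq hpc hqc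
  have hclosure : closure D ⊆ S2 := closure_minimal hDS Metric.isClosed_sphere
  obtain ⟨l, hl, hexp, hleq⟩ := exists_log_along_of_disk hf hinj hg
    (fun x hx hgx ↦ by
      rw [himg] at hx
      rcases hg0 x (hclosure hx) hgx with rfl | rfl
      exacts [hpD hx, hqD hx])
    hγ (fun t ↦ himg ▸ hsub (hγC t))
  exact log_circle_ne hw hl (fun t ↦ (hexp t).trans (hgγ t)) (hleq _ _ hper)
end
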